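/- Let U_s be an arbitrary admissible (monotone) shear flow. Then there exist positive constants ν̄, K, S, η such that for every ν ≤ ν̄ and every integer k with |k| ≥ K and k ν^{3/4} ≥ S, there exists μ_{k,ν} ∈ ℂ with Im μ_{k,ν} ≥ η ν^{3/4} k and a smooth function φ : [0,∞) → ℂ satisfying (μ_{k,ν} − U_s)φ' + U_s' φ − (i/k) φ''' = F, φ(0) = 0, φ'(0) = 1, φ'(y) → 0 and φ(y) → 1/(√ν k) as y → ∞. Equivalently, λ_{k,ν} := −i k μ_{k,ν} satisfies Re λ_{k,ν} ≥ η ν^{3/4} k² and the linearized IBL system displays a (λ_{k,ν}, k) instability. -/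

import Mathlib

open MeasureTheory Filter Set

noncomputable section

/-- The source term `F(y) = 1 - U(y) + y U'(y)` of the eigenmode ODE. -/
def srcF (U : ℝ → ℝ) (y : ℝ) : ℝ := 1 - U y + y * deriv U y

/-- The displacement thickness `Δ_s = ∫₀^∞ (1 - U)`. -/
def deltaS (U : ℝ → ℝ) : ℝ := ∫ y in Ioi (0:ℝ), (1 - U y)

/-- An admissible shear flow: smooth, monotone, `U(0) = 0`, `U → 1`,
`U''(0) ≠ 0`, finitely many inflexion points, and the decay conditions of the paper. -/
structure AdmissibleShearFlow (U : ℝ → ℝ) : Prop where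
  smooth : ContDiff ℝ (⊤ : ℕ∞) U
  mem_Ico : ∀ y, 0 ≤ y → U y ∈ Ico (0:ℝ) 1
  zero_val : U 0 = 0
  deriv_pos : ∀ y, 0 ≤ y → 0 < deriv U y
  tendsto_one : Tendsto U atTop (nhds 1)
  snd_deriv_zero_ne : iteratedDeriv 2 U 0 ≠ 0
  finite_inflexions : {y : ℝ | 0 < y ∧ iteratedDeriv 2 U y = 0}.Finite
  integrable_defect : IntegrableOn (fun y => 1 - U y) (Ioi (0:ℝ))
  derivs_bounded : ∀ j : ℕ, 1 ≤ j → j ≤ 3 →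
    ∃ M : ℝ, ∀ y, 0 ≤ y → |iteratedDeriv j U y| ≤ M
  decay_ratio₁ : Tendsto (fun y => (1 - U y) ^ 2 / deriv U y) atTop (nhds 0)
  decay_ratio₂ : Tendsto (fun y => y * (1 - U y)) atTop (nhds 0)
  decay_ratio₃ : IntegrableOn
    (fun y => (1 - U y) ^ 2 * iteratedDeriv 2 U y / (deriv U y) ^ 2) (Ioi (0:ℝ))
  kappa_decay : ∃ κ : ℝ, 0 < κ ∧ κ < 1/2 ∧ ∃ yκ > (0:ℝ), ∃ cκ > (0:ℝ),
    ∀ y, yκ ≤ y →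
      (1 - U y) ^ ((2:ℝ) - κ) * iteratedDeriv 2 U y ≤ -cκ * (deriv U y) ^ 3

/-- `φ` is a smooth solution of the eigenmode problem
`(μ - U_s)φ' + U_s'φ - (i/k)φ''' = F`, `φ(0) = 0`, `φ'(0) = 1`, `φ' → 0`, `φ → L`. -/
def IsEigSolution (U : ℝ → ℝ) (μ : ℂ) (k : ℝ) (L : ℂ) (φ : ℝ → ℂ) : Prop :=
  ContDiff ℝ (⊤ : ℕ∞) φ ∧
  (∀ y, 0 ≤ y →
    (μ - (U y : ℂ)) * deriv φ y + ((deriv U y : ℝ) : ℂ) * φ y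
      - Complex.I / (k : ℂ) * iteratedDeriv 3 φ y = (srcF U y : ℂ)) ∧
  φ 0 = 0 ∧ deriv φ 0 = 1 ∧
  Tendsto (deriv φ) atTop (nhds 0) ∧
  Tendsto φ atTop (nhds L)

/-- Same problem without the prescribed limit at infinity. -/
def IsBLSolution (U : ℝ → ℝ) (μ : ℂ) (k : ℝ) (φ : ℝ → ℂ) : Prop :=
  ContDiff ℝ (⊤ : ℕ∞) φ ∧
  (∀ y, 0 ≤ y →
    (μ - (U y : ℂ)) * deriv φ y + ((deriv U y : ℝ) : ℂ) * φ y
      - Complex.I / (k : ℂ) * iteratedDeriv 3 φ y = (srcF U y : ℂ)) ∧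
  φ 0 = 0 ∧ deriv φ 0 = 1 ∧ Tendsto (deriv φ) atTop (nhds 0)

/-- Cauchy principal value `PV ∫₀¹ h(u)/(u - a) du`. -/
def pvIntegral (h : ℝ → ℝ) (a : ℝ) : ℝ :=
  limUnder (nhdsWithin (0:ℝ) (Ioi 0))
    (fun ε => ∫ u in Ioo (0:ℝ) 1 \ Ioo (a - ε) (a + ε), h u / (u - a))

/-- Inverse of the shear flow on `[0, ∞)`. -/
def shearInv (U : ℝ → ℝ) (u : ℝ) : ℝ := Function.invFunOn U (Ici 0) u

/-- `g(u) = (1-u)² U''(U⁻¹(u)) / (U'(U⁻¹(u)))³`. -/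
def gfun (U : ℝ → ℝ) (u : ℝ) : ℝ :=
  (1 - u) ^ 2 * iteratedDeriv 2 U (shearInv U u) / (deriv U (shearInv U u)) ^ 3

/-- `G(a) = 1/(a U'(0)) + PV ∫₀¹ g(u)/(u-a) du + iπ g(a)`. -/
def Gfun (U : ℝ → ℝ) (a : ℝ) : ℂ :=
  ((1 / (a * deriv U 0) + pvIntegral (gfun U) a : ℝ) : ℂ)
    + Complex.I * ((Real.pi * gfun U a : ℝ) : ℂ)

/-- Crossing abscissa `χ(y) = Re G(U(y))`. -/
def chiAbscissa (U : ℝ → ℝ) (y : ℝ) : ℝ := (Gfun U (U y)).re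

/-- `ξ(γ)`: number of zeros of `U''` in `(0,∞)` with `χ(yᵢ) = γ`. -/
def xiEq (U : ℝ → ℝ) (γ : ℝ) : ℕ :=
  {y : ℝ | 0 < y ∧ iteratedDeriv 2 U y = 0 ∧ chiAbscissa U y = γ}.ncard

/-- `ξ₊(γ)`: zeros of `U''` with `χ(yᵢ) < γ`, `U'' < 0` on the left and `U'' > 0`
on the right. -/
def xiPlus (U : ℝ → ℝ) (γ : ℝ) : ℕ :=
  {y : ℝ | 0 < y ∧ iteratedDeriv 2 U y = 0 ∧ chiAbscissa U y < γ ∧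
    ∃ δ > (0:ℝ), (∀ z ∈ Ioo (y - δ) y, iteratedDeriv 2 U z < 0) ∧
      (∀ z ∈ Ioo y (y + δ), 0 < iteratedDeriv 2 U z)}.ncard

/-- `ξ₋(γ)`: zeros of `U''` with `χ(yᵢ) < γ`, `U'' > 0` on the left and `U'' < 0`
on the right. -/
def xiMinus (U : ℝ → ℝ) (γ : ℝ) : ℕ :=
  {y : ℝ | 0 < y ∧ iteratedDeriv 2 U y = 0 ∧ chiAbscissa U y < γ ∧
    ∃ δ > (0:ℝ), (∀ z ∈ Ioo (y - δ) y, 0 < iteratedDeriv 2 U z) ∧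
      (∀ z ∈ Ioo y (y + δ), iteratedDeriv 2 U z < 0)}.ncard

/-- `Φ_inv(μ) = (μ - 1) ∫₀^∞ F(y)/(μ - U(y))² dy`. -/
def PhiInv (U : ℝ → ℝ) (μ : ℂ) : ℂ :=
  (μ - 1) * ∫ y in Ioi (0:ℝ), (srcF U y : ℂ) / (μ - (U y : ℂ)) ^ 2

/-- A weight function `ω ≥ 1` with `C_ω < ∞`. -/
structure WeightFn (ω : ℝ → ℝ) : Prop where
  pos : ∀ y, 0 ≤ y → 0 < ω y
  contDiff : ContDiff ℝ 1 ω
  one_le : ∀ y, 0 ≤ y → 1 ≤ ω y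
  integrable_inv : IntegrableOn (fun y => 1 / ω y) (Ioi (0:ℝ))
  deriv_ratio_bdd : ∃ M : ℝ, ∀ y, 0 ≤ y → |deriv ω y / ω y| ≤ M
  log_ratio_bdd : ∃ M : ℝ, ∀ y, 0 ≤ y → Real.log (ω y) / (1 + y) ≤ M

/-- Weighted decay conditions: `(1-U_s) ∈ L²(ω)` and `(1+y)U_s^{(j)} ∈ L²(ω)`, `j = 1,2,3`. -/
def WeightedDecay (U ω : ℝ → ℝ) : Prop :=
  IntegrableOn (fun y => (1 - U y) ^ 2 * ω y) (Ioi (0:ℝ)) ∧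
  ∀ j : ℕ, 1 ≤ j → j ≤ 3 →
    IntegrableOn (fun y => ((1 + y) * iteratedDeriv j U y) ^ 2 * ω y) (Ioi (0:ℝ))

/-- Membership in the weighted space `L²(ω)`. -/
def MemL2w (ω : ℝ → ℝ) (f : ℝ → ℂ) : Prop :=
  IntegrableOn (fun y => ‖f y‖ ^ 2 * ω y) (Ioi (0:ℝ))

/-- The `L²(ω)` norm. -/
def wNorm (ω : ℝ → ℝ) (f : ℝ → ℂ) : ℝ :=
  Real.sqrt (∫ y in Ioi (0:ℝ), ‖f y‖ ^ 2 * ω y)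

/-- `φ` solves the homogeneous-boundary-conditions resolvent problem with forcing `f`. -/
def SolvesHom (U : ℝ → ℝ) (μ : ℂ) (k : ℝ) (f φ : ℝ → ℂ) : Prop :=
  ContDiff ℝ 2 φ ∧
  (∀ᵐ y ∂(volume.restrict (Ioi (0:ℝ))),
    (μ - (U y : ℂ)) * deriv φ y + ((deriv U y : ℝ) : ℂ) * φ y
      - Complex.I / (k : ℂ) * iteratedDeriv 3 φ y = f y) ∧
  φ 0 = 0 ∧ deriv φ 0 = 0 ∧ Tendsto (deriv φ) atTop (nhds 0)

/-- Parameterization on `[0,1]` of the contour `C_η`: the segment from `iη` to `1 + iη`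
followed by the upper half-circle of radius `1/2` centered at `1/2 + iη`. -/
def Ceta (η : ℝ) (t : ℝ) : ℂ :=
  if t ≤ 1/2 then ((2*t : ℝ) : ℂ) + (η : ℂ) * Complex.I
  else (1/2 : ℂ) + (η : ℂ) * Complex.I
    + (1/2 : ℂ) * Complex.exp (((Real.pi * (2*t - 1) : ℝ)) * Complex.I)

/-- Winding number `(1/2πi) ∮ dz/(z - p)` of a closed curve parameterized on `[0,1]`. -/
def windingNumber (c : ℝ → ℂ) (p : ℂ) : ℂ :=
  (((2 * Real.pi : ℝ) : ℂ) * Complex.I)⁻¹ * ∫ t in (0:ℝ)..1, deriv c t / (c t - p)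

/-- `q_μ(x) = |μ - x|⁴ - (2μ - 1 - x)(μ̄ - x)²`. -/
def qmu (μ : ℂ) (x : ℝ) : ℂ :=
  ((‖μ - (x:ℂ)‖ ^ 4 : ℝ) : ℂ) - (2*μ - 1 - (x:ℂ)) * ((starRingEnd ℂ) μ - (x:ℂ))^2

/-- `f(α) = -2iΔ_s/α + 1/√α`, principal square root (positive real part for `Re α > 0`). -/
def fIBL (Δ : ℝ) (α : ℂ) : ℂ := (-2 * Complex.I * (Δ:ℂ)) / α + 1 / (α ^ (1/2 : ℂ))


/-! ### Elementary exponential estimates -/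

lemma ibl_exp_abs_integrable {a : ℝ} (ha : 0 < a) :
    Integrable (fun x : ℝ => Real.exp (-a * |x|)) := by
  have h := integrableOn_exp_mul_Ioi (a := -a) (by linarith) 0
  have h1 : IntegrableOn (fun x : ℝ => Real.exp (-a * |x|)) (Ioi 0) :=
    h.congr_fun (fun x hx => by simp only [abs_of_pos (mem_Ioi.1 hx)]) measurableSet_Ioi
  have h2 : IntegrableOn (fun x : ℝ => Real.exp (-a * |x|)) (Iic 0) := by
    have h3 := integrableOn_exp_mul_Iic (a := a) ha 0
    exact h3.congr_fun (fun x hx => by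
      simp only [abs_of_nonpos (mem_Iic.1 hx)]; congr 1; ring) measurableSet_Iic
  have := h2.union h1
  rwa [Iic_union_Ioi, integrableOn_univ] at this

lemma ibl_exp_abs_integral {a : ℝ} (ha : 0 < a) :
    ∫ x : ℝ, Real.exp (-a * |x|) = 2 / a := by
  rw [integral_comp_abs (f := fun x => Real.exp (-a * x)),
    integral_exp_mul_Ioi (by linarith)]
  simp
  field_simp

/-- Integral operator with exponentially decaying kernel. -/
lemma ibl_kernel_L1 (G : ℝ → ℝ → ℂ) (A a : ℝ) (hA : 0 ≤ A) (ha : 0 < a)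
    (hG : Continuous (Function.uncurry G))
    (hb : ∀ y z, ‖G y z‖ ≤ A * Real.exp (-a * |y - z|))
    (f : ℝ → ℂ) (hf : IntegrableOn f (Ioi 0)) :
    (∀ y, IntegrableOn (fun z => G y z * f z) (Ioi 0)) ∧
    Continuous (fun y => ∫ z in Ioi (0:ℝ), G y z * f z) ∧
    IntegrableOn (fun y => ∫ z in Ioi (0:ℝ), G y z * f z) (Ioi 0) ∧
    ∫ y in Ioi (0:ℝ), ‖∫ z in Ioi (0:ℝ), G y z * f z‖ ≤ 2 * A / a * ∫ z in Ioi (0:ℝ), ‖f z‖ := by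
  have hbA : ∀ y z, ‖G y z‖ ≤ A := fun y z => (hb y z).trans (by
    have : Real.exp (-a * |y - z|) ≤ 1 := Real.exp_le_one_iff.2 (by
      have := abs_nonneg (y - z); nlinarith)
    nlinarith)
  have hmeas : ∀ y, AEStronglyMeasurable (fun z => G y z * f z) (volume.restrict (Ioi 0)) := by
    intro y
    have : Continuous (G y) := hG.comp (Continuous.prodMk_right y)
    exact this.aestronglyMeasurable.mul hf.aestronglyMeasurable
  have hpt : ∀ y z, ‖G y z * f z‖ ≤ A * ‖f z‖ := fun y z => by
    rw [norm_mul]; exact mul_le_mul_of_nonneg_right (hbA y z) (norm_nonneg _)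
  have hInt0 : ∀ y, IntegrableOn (fun z => G y z * f z) (Ioi 0) := fun y =>
    Integrable.mono' (hf.norm.const_mul A) (hmeas y) (Eventually.of_forall (hpt y))
  have hcont : Continuous (fun y => ∫ z in Ioi (0:ℝ), G y z * f z) := by
    refine continuous_of_dominated hmeas (bound := fun z => A * ‖f z‖)
      (fun y => Eventually.of_forall (hpt y)) (hf.norm.const_mul A) ?_
    refine Eventually.of_forall fun z => ?_
    exact (hG.comp (Continuous.prodMk_left z)).mul continuous_const
  -- majorant: a convolution
  let E : ℝ → ℝ := fun x => Real.exp (-a * |x|)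
  let f1 : ℝ → ℝ := (Ioi (0:ℝ)).indicator (fun z => ‖f z‖)
  have hE : Integrable E := ibl_exp_abs_integrable ha
  have hf1 : Integrable f1 := (integrable_indicator_iff measurableSet_Ioi).2 hf.norm
  let C : ℝ → ℝ := convolution f1 E (ContinuousLinearMap.mul ℝ ℝ) volume
  have hC : Integrable C := hf1.integrable_convolution _ hE
  have hCint : ∫ y, C y = (∫ z in Ioi (0:ℝ), ‖f z‖) * (2 / a) := by
    have := integral_convolution (ContinuousLinearMap.mul ℝ ℝ) (μ := volume) (ν := volume) hf1 hE
    rw [show (∫ y, C y) = _ from this, ibl_exp_abs_integral ha]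
    simp only [ContinuousLinearMap.mul_apply']
    congr 1
    exact integral_indicator measurableSet_Ioi
  have hCeq : ∀ y, C y = ∫ z in Ioi (0:ℝ), ‖f z‖ * E (y - z) := by
    intro y
    simp only [C, convolution, ContinuousLinearMap.mul_apply']
    rw [← integral_indicator measurableSet_Ioi]
    congr 1; ext z
    by_cases hz : z ∈ Ioi (0:ℝ) <;> simp [f1, hz]
  have hCnn : ∀ y, 0 ≤ C y := fun y => by
    rw [hCeq]; exact integral_nonneg fun z => mul_nonneg (norm_nonneg _) (Real.exp_pos _).le
  have hle : ∀ y, ‖∫ z in Ioi (0:ℝ), G y z * f z‖ ≤ A * C y := by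
    intro y
    rw [hCeq, ← integral_const_mul]
    refine norm_integral_le_of_norm_le ?_ (Eventually.of_forall fun z => ?_)
    · refine Integrable.const_mul ?_ A
      refine Integrable.mono' hf.norm ?_ (Eventually.of_forall fun z => ?_)
      · refine hf.norm.aestronglyMeasurable.mul (Continuous.aestronglyMeasurable ?_)
        fun_prop
      · rw [Real.norm_eq_abs, abs_of_nonneg (mul_nonneg (norm_nonneg _) (Real.exp_pos _).le)]
        have : E (y - z) ≤ 1 := Real.exp_le_one_iff.2 (by
          have := abs_nonneg (y - z); nlinarith)
        nlinarith [norm_nonneg (f z)]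
    · rw [norm_mul]
      calc ‖G y z‖ * ‖f z‖ ≤ (A * E (y - z)) * ‖f z‖ :=
            mul_le_mul_of_nonneg_right (hb y z) (norm_nonneg _)
        _ = _ := by ring
  have hI : IntegrableOn (fun y => ∫ z in Ioi (0:ℝ), G y z * f z) (Ioi 0) :=
    Integrable.mono' (hC.integrableOn.const_mul A) hcont.aestronglyMeasurable
      (Eventually.of_forall hle)
  refine ⟨hInt0, hcont, hI, ?_⟩
  calc ∫ y in Ioi (0:ℝ), ‖∫ z in Ioi (0:ℝ), G y z * f z‖
      ≤ ∫ y in Ioi (0:ℝ), A * C y := integral_mono hI.norm (hC.integrableOn.const_mul A) hle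
    _ ≤ ∫ y, A * C y := setIntegral_le_integral (hC.const_mul A)
        (Eventually.of_forall fun y => mul_nonneg hA (hCnn y))
    _ = 2 * A / a * ∫ z in Ioi (0:ℝ), ‖f z‖ := by
        rw [integral_const_mul, hCint]; ring

lemma ibl_norm_exp (m : ℂ) (s : ℝ) : ‖Complex.exp (-m * s)‖ = Real.exp (-m.re * s) := by
  rw [Complex.norm_exp]; simp

lemma ibl_norm_exp_le {m : ℂ} {c : ℝ} (hm : c ≤ m.re) {s : ℝ} (hs : 0 ≤ s) :
    ‖Complex.exp (-m * s)‖ ≤ Real.exp (-c * s) := by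
  rw [ibl_norm_exp]; apply Real.exp_le_exp.2; nlinarith

lemma ibl_exp_sub_le0 {m m' : ℂ} {c : ℝ} (hm : c ≤ m.re) (hm' : c ≤ m'.re) {s : ℝ}
    (hs : 0 ≤ s) :
    ‖Complex.exp (-m * s) - Complex.exp (-m' * s)‖ ≤ s * Real.exp (-c * s) * ‖m - m'‖ := by
  have hconv : Convex ℝ {z : ℂ | c ≤ z.re} := convex_halfSpace_re_ge c
  refine hconv.norm_image_sub_le_of_norm_hasDerivWithin_le
    (f := fun z : ℂ => Complex.exp (-z * s)) (f' := fun z => Complex.exp (-z * s) * (-1 * s))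
    (fun z _ => ?_) (fun z hz => ?_) hm' hm
  · exact (((hasDerivAt_id z).neg.mul_const (s : ℂ)).cexp).hasDerivWithinAt
  · rw [norm_mul]
    have h1 := ibl_norm_exp_le (show c ≤ z.re from hz) hs
    have h2 : ‖(-1 * s : ℂ)‖ = s := by simp [abs_of_nonneg hs]
    rw [h2, mul_comm]
    exact mul_le_mul_of_nonneg_left h1 hs

lemma ibl_s_exp {c s : ℝ} (hc : 0 < c) :
    s * Real.exp (-c * s) ≤ 2 / c * Real.exp (-(c / 2) * s) := by
  have h1 : c / 2 * s ≤ Real.exp (c / 2 * s) := by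
    have := Real.add_one_le_exp (c / 2 * s); linarith
  have h2 : Real.exp (-(c/2) * s) = Real.exp (c / 2 * s) * Real.exp (-c * s) := by
    rw [← Real.exp_add]; congr 1; ring
  rw [h2, ← mul_assoc]
  apply mul_le_mul_of_nonneg_right _ (Real.exp_pos _).le
  rw [div_mul_eq_mul_div, le_div_iff₀ hc]; linarith

lemma ibl_exp_sub_le {m m' : ℂ} {c : ℝ} (hc : 0 < c) (hm : c ≤ m.re) (hm' : c ≤ m'.re) {s : ℝ}
    (hs : 0 ≤ s) :
    ‖Complex.exp (-m * s) - Complex.exp (-m' * s)‖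
      ≤ ‖m - m'‖ * (2 / c) * Real.exp (-(c / 2) * s) := by
  refine (ibl_exp_sub_le0 hm hm' hs).trans ?_
  have := mul_le_mul_of_nonneg_right (ibl_s_exp (s := s) hc) (norm_nonneg (m - m'))
  linarith

/-- The Dirichlet Green kernel of `m² - ∂²`. -/
def gKer (m : ℂ) (y z : ℝ) : ℂ :=
  (Complex.exp (-m * (|y - z| : ℝ)) - Complex.exp (-m * (|y| + |z| : ℝ))) / (2 * m)

lemma gKer_cont (m : ℂ) : Continuous (Function.uncurry (gKer m)) := by
  unfold gKer Function.uncurry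
  fun_prop

lemma ibl_abs_tri (y z : ℝ) : |y - z| ≤ |y| + |z| := abs_sub y z

lemma gKer_bound {m : ℂ} {c : ℝ} (hc : 0 < c) (hm : c ≤ m.re) (y z : ℝ) :
    ‖gKer m y z‖ ≤ 1 / c * Real.exp (-c * |y - z|) := by
  have hcm : c ≤ ‖m‖ := hm.trans (Complex.re_le_norm m)
  unfold gKer
  rw [norm_div, norm_mul, Complex.norm_two]
  have h1 := ibl_norm_exp_le hm (abs_nonneg (y - z))
  have h2 := ibl_norm_exp_le hm (add_nonneg (abs_nonneg y) (abs_nonneg z))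
  have h3 : Real.exp (-c * (|y| + |z|)) ≤ Real.exp (-c * |y - z|) :=
    Real.exp_le_exp.2 (by nlinarith [ibl_abs_tri y z])
  have h4 := norm_sub_le (Complex.exp (-m * (|y - z| : ℝ))) (Complex.exp (-m * (|y| + |z| : ℝ)))
  rw [div_le_iff₀ (by linarith)]
  have h5 : 1 ≤ 1 / c * ‖m‖ := by rw [one_div, inv_mul_eq_div, le_div_iff₀ hc]; linarith
  push_cast at *
  nlinarith [Real.exp_pos (-c * |y - z|)]

lemma gKer_sub_bound {m m' : ℂ} {c : ℝ} (hc : 0 < c) (hm : c ≤ m.re) (hm' : c ≤ m'.re)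
    (y z : ℝ) :
    ‖gKer m y z - gKer m' y z‖ ≤ 3 * ‖m - m'‖ / c ^ 2 * Real.exp (-(c / 2) * |y - z|) := by
  have hcm : c ≤ ‖m‖ := hm.trans (Complex.re_le_norm m)
  have hcm' : c ≤ ‖m'‖ := hm'.trans (Complex.re_le_norm m')
  have hm0 : m ≠ 0 := norm_pos_iff.1 (hc.trans_le hcm)
  have hm0' : m' ≠ 0 := norm_pos_iff.1 (hc.trans_le hcm')
  have key : ∀ s : ℝ, |y - z| ≤ s →
      ‖Complex.exp (-m * s) / (2 * m) - Complex.exp (-m' * s) / (2 * m')‖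
        ≤ 3 / 2 * ‖m - m'‖ / c ^ 2 * Real.exp (-(c / 2) * |y - z|) := by
    intro s hs'
    have hs : 0 ≤ s := (abs_nonneg _).trans hs'
    have e : Complex.exp (-m * s) / (2 * m) - Complex.exp (-m' * s) / (2 * m')
        = (Complex.exp (-m * s) - Complex.exp (-m' * s)) / (2 * m)
          + Complex.exp (-m' * s) * ((m' - m) / (2 * m * m')) := by
      field_simp; ring
    rw [e]
    refine (norm_add_le _ _).trans ?_
    have h1 := ibl_exp_sub_le hc hm hm' hs
    have h2 := ibl_norm_exp_le hm' hs
    have h3 : Real.exp (-(c / 2) * s) ≤ Real.exp (-(c / 2) * |y - z|) :=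
      Real.exp_le_exp.2 (by nlinarith)
    have h4 : Real.exp (-c * s) ≤ Real.exp (-(c / 2) * |y - z|) :=
      Real.exp_le_exp.2 (by nlinarith)
    set X := Real.exp (-(c / 2) * |y - z|)
    have hX : 0 < X := Real.exp_pos _
    have b1 : ‖(Complex.exp (-m * s) - Complex.exp (-m' * s)) / (2 * m)‖
        ≤ ‖m - m'‖ * (2 / c) * X / (2 * c) := by
      rw [norm_div, norm_mul, Complex.norm_two]
      gcongr
      refine h1.trans ?_
      gcongr
    have b2 : ‖Complex.exp (-m' * s) * ((m' - m) / (2 * m * m'))‖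
        ≤ X * (‖m - m'‖ / (2 * c * c)) := by
      rw [norm_mul, norm_div, norm_mul, norm_mul, Complex.norm_two, norm_sub_rev m' m]
      gcongr
      exact h2.trans h4
    refine (add_le_add b1 b2).trans (le_of_eq ?_)
    field_simp; ring
  have e : gKer m y z - gKer m' y z
      = (Complex.exp (-m * (|y - z| : ℝ)) / (2 * m) - Complex.exp (-m' * (|y - z| : ℝ)) / (2 * m'))
       - (Complex.exp (-m * (|y| + |z| : ℝ)) / (2 * m)
          - Complex.exp (-m' * (|y| + |z| : ℝ)) / (2 * m')) := by
    unfold gKer; ring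
  rw [e]
  refine (norm_sub_le _ _).trans ?_
  have k1 := key _ le_rfl
  have k2 := key _ (ibl_abs_tri y z)
  push_cast at *
  refine (add_le_add k1 k2).trans (le_of_eq ?_)
  ring


/-! ### Facts about the shear flow -/

section flow

variable {U : ℝ → ℝ}

lemma ibl_deriv_cont (hU : AdmissibleShearFlow U) : Continuous (deriv U) :=
  hU.smooth.continuous_deriv (by exact_mod_cast le_top)

lemma ibl_hasDeriv (hU : AdmissibleShearFlow U) (y : ℝ) : HasDerivAt U (deriv U y) y :=
  ((hU.smooth.differentiable (by simp)) y).hasDerivAt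

lemma ibl_srcF_cont (hU : AdmissibleShearFlow U) : Continuous (srcF U) := by
  have := ibl_deriv_cont hU
  have := hU.smooth.continuous
  unfold srcF; fun_prop

lemma ibl_U_le (hU : AdmissibleShearFlow U) {y : ℝ} (hy : 0 ≤ y) : |U y| ≤ 1 := by
  have := hU.mem_Ico y hy
  rw [abs_of_nonneg this.1]; exact this.2.le

lemma ibl_dU_int (hU : AdmissibleShearFlow U) : IntegrableOn (deriv U) (Ioi 0) :=
  integrableOn_Ioi_deriv_of_nonneg' (fun y _ => ibl_hasDeriv hU y)
    (fun y hy => (hU.deriv_pos y (le_of_lt hy)).le) hU.tendsto_one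

lemma ibl_dU_integral (hU : AdmissibleShearFlow U) : ∫ y in Ioi (0:ℝ), deriv U y = 1 := by
  rw [integral_Ioi_of_hasDerivAt_of_nonneg' (fun y _ => ibl_hasDeriv hU y)
    (fun y hy => (hU.deriv_pos y (le_of_lt hy)).le) hU.tendsto_one, hU.zero_val, sub_zero]

lemma ibl_yU_aux (hU : AdmissibleShearFlow U) :
    IntegrableOn (fun y => y * deriv U y) (Ioi 0) ∧
      ∫ y in Ioi (0:ℝ), y * deriv U y = deltaS U := by
  let g : ℝ → ℝ := fun y => -(y * (1 - U y)) + ∫ x in (0:ℝ)..y, (1 - U x)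
  have hc : Continuous fun x => 1 - U x := continuous_const.sub hU.smooth.continuous
  have hd : ∀ y ∈ Ici (0:ℝ), HasDerivAt g (y * deriv U y) y := by
    intro y _
    have h1 := ((hasDerivAt_id y).mul ((ibl_hasDeriv hU y).const_sub 1)).neg
    have h2 := (hc.integral_hasStrictDerivAt 0 y).hasDerivAt
    refine (h1.add h2).congr_deriv ?_
    simp
    ring
  have hpos : ∀ y ∈ Ioi (0:ℝ), 0 ≤ y * deriv U y := fun y hy =>
    mul_nonneg (le_of_lt hy) (hU.deriv_pos y (le_of_lt hy)).le
  have hlim : Tendsto g atTop (nhds (-0 + deltaS U)) :=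
    hU.decay_ratio₂.neg.add (intervalIntegral_tendsto_integral_Ioi 0 hU.integrable_defect tendsto_id)
  refine ⟨integrableOn_Ioi_deriv_of_nonneg' hd hpos hlim, ?_⟩
  rw [integral_Ioi_of_hasDerivAt_of_nonneg' hd hpos hlim]
  simp [g]

lemma ibl_srcF_int (hU : AdmissibleShearFlow U) : IntegrableOn (srcF U) (Ioi 0) :=
  hU.integrable_defect.add (ibl_yU_aux hU).1

lemma ibl_srcF_integral (hU : AdmissibleShearFlow U) :
    ∫ y in Ioi (0:ℝ), srcF U y = 2 * deltaS U := by
  unfold srcF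
  rw [integral_add hU.integrable_defect (ibl_yU_aux hU).1, (ibl_yU_aux hU).2]
  unfold deltaS; ring

lemma ibl_srcF_nonneg (hU : AdmissibleShearFlow U) {y : ℝ} (hy : 0 ≤ y) : 0 ≤ srcF U y := by
  have h1 := (hU.mem_Ico y hy).2
  have h2 := mul_nonneg hy (hU.deriv_pos y hy).le
  unfold srcF; linarith

lemma ibl_delta_pos (hU : AdmissibleShearFlow U) : 0 < deltaS U := by
  unfold deltaS
  rw [setIntegral_pos_iff_support_of_nonneg_ae]
  · have : (Function.support fun y => 1 - U y) ∩ Ioi 0 = Ioi 0 := by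
      ext y
      simp only [mem_inter_iff, Function.mem_support, mem_Ioi, and_iff_right_iff_imp]
      intro hy
      have := (hU.mem_Ico y hy.le).2
      linarith
    rw [this]; simp
  · filter_upwards [ae_restrict_mem measurableSet_Ioi] with y hy
    have := (hU.mem_Ico y (le_of_lt hy)).2
    simp; linarith
  · exact hU.integrable_defect

lemma ibl_srcF_bdd (hU : AdmissibleShearFlow U) :
    ∃ M : ℝ, 0 ≤ M ∧ ∀ y, 0 ≤ y → |srcF U y| ≤ M := by
  obtain ⟨κ, hκ0, hκ, y0, hy0, c, hc, H⟩ := hU.kappa_decay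
  have hneg : ∀ y, y0 ≤ y → deriv (deriv U) y ≤ 0 := by
    intro y hy
    have h := H y hy
    have hy' : 0 ≤ y := hy0.le.trans hy
    have h1 := (hU.mem_Ico y hy').2
    have h2 := hU.deriv_pos y hy'
    have h3 : 0 < (1 - U y) ^ ((2:ℝ) - κ) := Real.rpow_pos_of_pos (by linarith) _
    rw [iteratedDeriv_succ, iteratedDeriv_one] at h
    by_contra hcon
    push Not at hcon
    have := mul_pos h3 hcon
    have : 0 < c * deriv U y ^ 3 := by positivity
    linarith
  have h2U : ContDiff ℝ (1 + 1) U := by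
    rw [one_add_one_eq_two]; exact contDiff_infty.1 hU.smooth 2
  have hsm : ContDiff ℝ 1 (deriv U) := (contDiff_succ_iff_deriv.1 h2U).2.2
  have hanti : AntitoneOn (deriv U) (Ici y0) := by
    refine antitoneOn_of_deriv_nonpos (convex_Ici y0) (ibl_deriv_cont hU).continuousOn
      (hsm.differentiable (by simp)).differentiableOn ?_
    intro y hy
    rw [interior_Ici] at hy
    exact hneg y (le_of_lt hy)
  obtain ⟨C, hC⟩ := (isCompact_Icc (a := (0:ℝ)) (b := 2 * y0)).exists_bound_of_continuousOn
    (ibl_srcF_cont hU).continuousOn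
  refine ⟨max C 3, le_max_of_le_right (by norm_num), fun y hy => ?_⟩
  by_cases hyy : y ≤ 2 * y0
  · exact (hC y ⟨hy, hyy⟩).trans (le_max_left _ _)
  · push Not at hyy
    refine le_trans ?_ (le_max_right _ _)
    rw [abs_of_nonneg (ibl_srcF_nonneg hU hy)]
    have h0 := hU.mem_Ico y hy
    have h2 := hU.mem_Ico (y/2) (by linarith)
    obtain ⟨x, hx, hxe⟩ := exists_hasDerivAt_eq_slope U (deriv U) (show y/2 < y by linarith)
      hU.smooth.continuous.continuousOn (fun x _ => ibl_hasDeriv hU x)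
    have h3 : deriv U y ≤ deriv U x := hanti (by simp; linarith [hx.1]) (by simp; linarith) hx.2.le
    rw [eq_div_iff (by linarith)] at hxe
    unfold srcF
    have h4 : y / 2 * deriv U y ≤ y / 2 * deriv U x := mul_le_mul_of_nonneg_left h3 (by linarith)
    have h5 := h0.1; have h6 := h0.2; have h7 := h2.1
    nlinarith

end flow

/-! ### The perturbation operator -/

/-- `H w = U w - U' ∫₀ w`. -/
def opH (U : ℝ → ℝ) (w : ℝ → ℂ) (z : ℝ) : ℂ :=
  (U z : ℂ) * w z - ((deriv U z : ℝ) : ℂ) * ∫ x in (0:ℝ)..z, w x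

lemma ibl_prim_contOn {w : ℝ → ℂ} (hw : IntegrableOn w (Ioi 0)) :
    ContinuousOn (fun z => ∫ x in (0:ℝ)..z, w x) (Ici 0) := by
  have h1 : Integrable ((Ioi (0:ℝ)).indicator w) := (integrable_indicator_iff measurableSet_Ioi).2 hw
  have h2 : Continuous fun z => ∫ x in (0:ℝ)..z, (Ioi (0:ℝ)).indicator w x :=
    intervalIntegral.continuous_primitive (fun a b => h1.intervalIntegrable) 0
  refine h2.continuousOn.congr fun z hz => ?_
  have hz' : (0:ℝ) ≤ z := hz
  simp only
  rw [intervalIntegral.integral_of_le hz', intervalIntegral.integral_of_le hz']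
  refine setIntegral_congr_fun measurableSet_Ioc fun x hx => ?_
  simp [hx.1]

lemma ibl_prim_le {w : ℝ → ℂ} (hw : IntegrableOn w (Ioi 0)) {z : ℝ} (hz : 0 ≤ z) :
    ‖∫ x in (0:ℝ)..z, w x‖ ≤ ∫ x in Ioi (0:ℝ), ‖w x‖ := by
  rw [intervalIntegral.integral_of_le hz]
  refine (norm_integral_le_integral_norm _).trans ?_
  exact setIntegral_mono_set hw.norm (Eventually.of_forall fun x => norm_nonneg _)
    (Ioc_subset_Ioi_self).eventuallyLE

lemma opH_int {U : ℝ → ℝ} (hU : AdmissibleShearFlow U) {w : ℝ → ℂ} (hw : IntegrableOn w (Ioi 0)) :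
    IntegrableOn (opH U w) (Ioi 0) ∧
    ∫ z in Ioi (0:ℝ), ‖opH U w z‖ ≤ 2 * ∫ z in Ioi (0:ℝ), ‖w z‖ := by
  set N := ∫ z in Ioi (0:ℝ), ‖w z‖
  have hm : AEStronglyMeasurable (opH U w) (volume.restrict (Ioi 0)) := by
    refine AEStronglyMeasurable.sub ?_ ?_
    · exact ((Complex.continuous_ofReal.comp hU.smooth.continuous).aestronglyMeasurable).mul
        hw.aestronglyMeasurable
    · refine ((Complex.continuous_ofReal.comp (ibl_deriv_cont hU)).aestronglyMeasurable).mul ?_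
      exact ((ibl_prim_contOn hw).mono Ioi_subset_Ici_self).aestronglyMeasurable measurableSet_Ioi
  have hb : ∀ z ∈ Ioi (0:ℝ), ‖opH U w z‖ ≤ ‖w z‖ + deriv U z * N := by
    intro z hz
    have hz' : (0:ℝ) ≤ z := le_of_lt hz
    refine (norm_sub_le _ _).trans ?_
    rw [norm_mul, norm_mul, Complex.norm_real, Complex.norm_real, Real.norm_eq_abs,
      Real.norm_eq_abs, abs_of_pos (hU.deriv_pos z hz')]
    have h1 := ibl_U_le hU hz'
    have h2 := ibl_prim_le hw hz'
    have h3 := hU.deriv_pos z hz'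
    gcongr
    nlinarith [norm_nonneg (w z)]
  have hi : IntegrableOn (fun z => ‖w z‖ + deriv U z * N) (Ioi 0) :=
    hw.norm.add ((ibl_dU_int hU).mul_const N)
  have hI : IntegrableOn (opH U w) (Ioi 0) := Integrable.mono' hi hm (by
    filter_upwards [ae_restrict_mem measurableSet_Ioi] with z hz using hb z hz)
  refine ⟨hI, ?_⟩
  refine (setIntegral_mono_on hI.norm hi measurableSet_Ioi hb).trans (le_of_eq ?_)
  rw [integral_add hw.norm ((ibl_dU_int hU).mul_const N), integral_mul_const, ibl_dU_integral hU]
  ring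

lemma ibl_intervalInt {w : ℝ → ℂ} (hw : IntegrableOn w (Ioi 0)) {z : ℝ} (hz : 0 ≤ z) :
    IntervalIntegrable w volume 0 z := by
  rw [intervalIntegrable_iff_integrableOn_Ioc_of_le hz]
  exact hw.mono_set Ioc_subset_Ioi_self

lemma opH_sub {U : ℝ → ℝ} {w w' : ℝ → ℂ} (hw : IntegrableOn w (Ioi 0))
    (hw' : IntegrableOn w' (Ioi 0)) {z : ℝ} (hz : 0 ≤ z) :
    opH U (fun x => w x - w' x) z = opH U w z - opH U w' z := by
  unfold opH
  rw [intervalIntegral.integral_sub (ibl_intervalInt hw hz) (ibl_intervalInt hw' hz)]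
  ring

lemma opH_congr {U : ℝ → ℝ} {w w' : ℝ → ℂ} (h : w =ᵐ[volume.restrict (Ioi 0)] w') :
    opH U w =ᵐ[volume.restrict (Ioi 0)] opH U w' := by
  filter_upwards [h, ae_restrict_mem measurableSet_Ioi] with z hz hz0
  unfold opH
  rw [hz]
  congr 2
  rw [intervalIntegral.integral_of_le (le_of_lt hz0), intervalIntegral.integral_of_le (le_of_lt hz0)]
  exact integral_congr_ae (ae_restrict_of_ae_restrict_of_subset Ioc_subset_Ioi_self h)


/-! ### The integral equation -/

lemma ibl_exp_Ioi_int {a : ℝ} (ha : 0 < a) : IntegrableOn (fun y : ℝ => Real.exp (-a * y)) (Ioi 0) :=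
  integrableOn_exp_mul_Ioi (by linarith) 0

lemma ibl_exp_Ioi {a : ℝ} (ha : 0 < a) : ∫ y in Ioi (0:ℝ), Real.exp (-a * y) = 1 / a := by
  rw [integral_exp_mul_Ioi (by linarith)]
  simp

/-- General domination lemma on the half line. -/
lemma ibl_dom {f : ℝ → ℂ} {g : ℝ → ℝ} (hf : AEStronglyMeasurable f (volume.restrict (Ioi 0)))
    (hg : IntegrableOn g (Ioi 0)) (h : ∀ y, 0 < y → ‖f y‖ ≤ g y) :
    IntegrableOn f (Ioi 0) ∧ ∫ y in Ioi (0:ℝ), ‖f y‖ ≤ ∫ y in Ioi (0:ℝ), g y := by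
  have hI : IntegrableOn f (Ioi 0) := Integrable.mono' hg hf (by
    filter_upwards [ae_restrict_mem measurableSet_Ioi] with z hz using h z hz)
  exact ⟨hI, setIntegral_mono_on hI.norm hg measurableSet_Ioi h⟩

lemma ibl_cexp_cont (m : ℂ) : Continuous (fun y : ℝ => Complex.exp (-m * y)) := by fun_prop

lemma ibl_cexp_L1 {m : ℂ} {c : ℝ} (hc : 0 < c) (hm : c ≤ m.re) :
    IntegrableOn (fun y : ℝ => Complex.exp (-m * y)) (Ioi 0) ∧
    ∫ y in Ioi (0:ℝ), ‖Complex.exp (-m * y)‖ ≤ 1 / c := by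
  rw [← ibl_exp_Ioi hc]
  exact ibl_dom (ibl_cexp_cont m).aestronglyMeasurable (ibl_exp_Ioi_int hc)
    (fun y hy => ibl_norm_exp_le hm hy.le)

lemma ibl_srcC_int {U : ℝ → ℝ} (hU : AdmissibleShearFlow U) :
    IntegrableOn (fun z => (srcF U z : ℂ)) (Ioi 0) := (ibl_srcF_int hU).ofReal

lemma ibl_srcC_norm {U : ℝ → ℝ} (hU : AdmissibleShearFlow U) :
    ∫ z in Ioi (0:ℝ), ‖(srcF U z : ℂ)‖ = 2 * deltaS U := by
  rw [← ibl_srcF_integral hU]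
  refine setIntegral_congr_fun measurableSet_Ioi fun z hz => ?_
  simp only [Complex.norm_real, Real.norm_eq_abs]
  exact abs_of_nonneg (ibl_srcF_nonneg hU (le_of_lt hz))

/-- The full forcing `F + H w`. -/
def opf (U : ℝ → ℝ) (w : ℝ → ℂ) (z : ℝ) : ℂ := (srcF U z : ℂ) + opH U w z

lemma opf_int {U : ℝ → ℝ} (hU : AdmissibleShearFlow U) {w : ℝ → ℂ} (hw : IntegrableOn w (Ioi 0)) :
    IntegrableOn (opf U w) (Ioi 0) ∧
    ∫ z in Ioi (0:ℝ), ‖opf U w z‖ ≤ 2 * deltaS U + 2 * ∫ z in Ioi (0:ℝ), ‖w z‖ := by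
  have h1 := ibl_srcC_int hU
  have h2 := opH_int hU hw
  refine ⟨h1.add h2.1, ?_⟩
  rw [← ibl_srcC_norm hU]
  refine le_trans ?_ (add_le_add_right h2.2 _)
  rw [← integral_add h1.norm h2.1.norm]
  exact integral_mono (h1.add h2.1).norm (h1.norm.add h2.1.norm) fun z => norm_add_le _ _

/-- One step of the Picard iteration. -/
def opStep (U : ℝ → ℝ) (m : ℂ) (k : ℝ) (w : ℝ → ℂ) (y : ℝ) : ℂ :=
  Complex.exp (-m * y) + (-Complex.I * k) * ∫ z in Ioi (0:ℝ), gKer m y z * opf U w z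

/-- Solutions of the integral equation. -/
def IsInt (U : ℝ → ℝ) (m : ℂ) (k : ℝ) (w : ℝ → ℂ) : Prop :=
  Continuous w ∧ IntegrableOn w (Ioi 0) ∧ ∀ y, w y = opStep U m k w y

lemma gKer_op {m : ℂ} {c : ℝ} (hc : 0 < c) (hm : c ≤ m.re) (f : ℝ → ℂ)
    (hf : IntegrableOn f (Ioi 0)) :
    (∀ y, IntegrableOn (fun z => gKer m y z * f z) (Ioi 0)) ∧
    Continuous (fun y => ∫ z in Ioi (0:ℝ), gKer m y z * f z) ∧
    IntegrableOn (fun y => ∫ z in Ioi (0:ℝ), gKer m y z * f z) (Ioi 0) ∧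
    ∫ y in Ioi (0:ℝ), ‖∫ z in Ioi (0:ℝ), gKer m y z * f z‖
      ≤ 2 / c ^ 2 * ∫ z in Ioi (0:ℝ), ‖f z‖ := by
  have := ibl_kernel_L1 (gKer m) (1 / c) c (by positivity) hc (gKer_cont m) (gKer_bound hc hm) f hf
  rwa [show 2 * (1 / c) / c = 2 / c ^ 2 by field_simp] at this

lemma opStep_int {U : ℝ → ℝ} (hU : AdmissibleShearFlow U) {m : ℂ} {c : ℝ} (hc : 0 < c)
    (hm : c ≤ m.re) (k : ℝ) {w : ℝ → ℂ} (hw : IntegrableOn w (Ioi 0)) :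
    Continuous (opStep U m k w) ∧ IntegrableOn (opStep U m k w) (Ioi 0) := by
  have h := gKer_op hc hm _ (opf_int hU hw).1
  exact ⟨(ibl_cexp_cont m).add (continuous_const.mul h.2.1),
    (ibl_cexp_L1 hc hm).1.add (h.2.2.1.const_mul _)⟩

lemma ibl_norm_Ik {k : ℝ} (hk : 0 ≤ k) : ‖(-Complex.I * k : ℂ)‖ = k := by
  simp [abs_of_nonneg hk]

lemma opf_sub {U : ℝ → ℝ} {w w' : ℝ → ℂ} (hw : IntegrableOn w (Ioi 0))
    (hw' : IntegrableOn w' (Ioi 0)) {z : ℝ} (hz : 0 ≤ z) :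
    opf U w z - opf U w' z = opH U (fun x => w x - w' x) z := by
  rw [opH_sub hw hw' hz]; unfold opf; ring

lemma opStep_sub {U : ℝ → ℝ} (hU : AdmissibleShearFlow U) {m : ℂ} {c : ℝ} (hc : 0 < c)
    (hm : c ≤ m.re) {k : ℝ} (hk : 0 ≤ k) (hkc : 8 * k ≤ c ^ 2) {w w' : ℝ → ℂ}
    (hw : IntegrableOn w (Ioi 0)) (hw' : IntegrableOn w' (Ioi 0)) :
    ∫ y in Ioi (0:ℝ), ‖opStep U m k w y - opStep U m k w' y‖
      ≤ 1 / 2 * ∫ y in Ioi (0:ℝ), ‖w y - w' y‖ := by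
  have hd : IntegrableOn (fun x => w x - w' x) (Ioi 0) := hw.sub hw'
  have hH := opH_int hU hd
  have e : ∀ y, opStep U m k w y - opStep U m k w' y
      = (-Complex.I * k) * ∫ z in Ioi (0:ℝ), gKer m y z * opH U (fun x => w x - w' x) z := by
    intro y
    have i1 := (gKer_op hc hm _ (opf_int hU hw).1).1 y
    have i2 := (gKer_op hc hm _ (opf_int hU hw').1).1 y
    have : ∫ z in Ioi (0:ℝ), gKer m y z * opH U (fun x => w x - w' x) z
        = (∫ z in Ioi (0:ℝ), gKer m y z * opf U w z)
          - ∫ z in Ioi (0:ℝ), gKer m y z * opf U w' z := by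
      rw [← integral_sub i1 i2]
      refine setIntegral_congr_fun measurableSet_Ioi fun z hz => ?_
      rw [← opf_sub hw hw' (le_of_lt hz)]; ring
    rw [this]; unfold opStep; ring
  simp only [e, norm_mul (-Complex.I * k : ℂ), ibl_norm_Ik hk]
  rw [integral_const_mul]
  have h1 := (gKer_op hc hm _ hH.1).2.2.2
  set N := ∫ y in Ioi (0:ℝ), ‖w y - w' y‖
  have hN : 0 ≤ N := integral_nonneg fun y => norm_nonneg _
  have h3 : 2 / c ^ 2 * ∫ z in Ioi (0:ℝ), ‖opH U (fun x => w x - w' x) z‖ ≤ 2 / c ^ 2 * (2 * N) :=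
    mul_le_mul_of_nonneg_left hH.2 (by positivity)
  refine (mul_le_mul_of_nonneg_left (h1.trans h3) hk).trans ?_
  rw [show k * (2 / c ^ 2 * (2 * N)) = (4 * k * N) / c ^ 2 by ring, div_le_iff₀ (by positivity)]
  nlinarith

lemma opStep_congr {U : ℝ → ℝ} {m : ℂ} {k : ℝ} {w w' : ℝ → ℂ}
    (h : w =ᵐ[volume.restrict (Ioi 0)] w') (y : ℝ) : opStep U m k w y = opStep U m k w' y := by
  unfold opStep
  congr 2
  refine integral_congr_ae ?_
  filter_upwards [opH_congr (U := U) h] with z hz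
  simp only [opf, hz]

lemma isInt_exists {U : ℝ → ℝ} (hU : AdmissibleShearFlow U) {m : ℂ} {c : ℝ} (hc : 0 < c)
    (hm : c ≤ m.re) {k : ℝ} (hk : 0 ≤ k) (hkc : 8 * k ≤ c ^ 2) : ∃ w, IsInt U m k w := by
  have hInt0 : ∀ w : (ℝ →₁[volume.restrict (Ioi (0:ℝ))] ℂ),
      Integrable (opStep U m k w) (volume.restrict (Ioi 0)) := fun w =>
    (opStep_int hU hc hm k (L1.integrable_coeFn w)).2
  let T : (ℝ →₁[volume.restrict (Ioi (0:ℝ))] ℂ) → (ℝ →₁[volume.restrict (Ioi (0:ℝ))] ℂ) :=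
    fun w => (hInt0 w).toL1 _
  have hT : ContractingWith (1/2) T := by
    refine ⟨by
      rw [← NNReal.coe_lt_coe]; norm_num, LipschitzWith.of_dist_le_mul fun w w' => ?_⟩
    rw [dist_eq_norm, dist_eq_norm]
    simp only [T]
    rw [← Integrable.toL1_sub _ _ (hInt0 w) (hInt0 w'), L1.norm_of_fun_eq_integral_norm, L1.norm_eq_integral_norm]
    have := opStep_sub hU hc hm hk hkc (L1.integrable_coeFn w) (L1.integrable_coeFn w')
    have e : ∫ a in Ioi (0:ℝ), ‖(w - w') a‖ = ∫ a in Ioi (0:ℝ), ‖w a - w' a‖ := by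
      refine integral_congr_ae ?_
      filter_upwards [Lp.coeFn_sub w w'] with a ha
      rw [ha]; rfl
    rw [e]
    simpa using this
  obtain ⟨w, hw, -⟩ := hT.exists_fixedPoint 0 (edist_ne_top _ _)
  have hwi := L1.integrable_coeFn w
  have hv := opStep_int hU hc hm k hwi
  have hae : opStep U m k w =ᵐ[volume.restrict (Ioi 0)] w := by
    have h1 := Integrable.coeFn_toL1 hv.2
    have h2 : Integrable.toL1 _ hv.2 = w := hw
    rw [h2] at h1
    exact h1.symm
  exact ⟨opStep U m k w, hv.1, hv.2, fun y => (opStep_congr hae y).symm⟩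

lemma isInt_norm {U : ℝ → ℝ} (hU : AdmissibleShearFlow U) {m : ℂ} {c : ℝ} (hc : 0 < c)
    (hm : c ≤ m.re) {k : ℝ} (hk : 0 ≤ k) (hkc : 8 * k ≤ c ^ 2) {w : ℝ → ℂ} (h : IsInt U m k w) :
    ∫ y in Ioi (0:ℝ), ‖w y‖ ≤ 2 / c + 8 * k * deltaS U / c ^ 2 := by
  obtain ⟨-, hw, he⟩ := h
  have hf := opf_int hU hw
  have hg := gKer_op hc hm _ hf.1
  have hE := ibl_cexp_L1 hc hm
  set N := ∫ y in Ioi (0:ℝ), ‖w y‖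
  have h1 : N ≤ (∫ y in Ioi (0:ℝ), ‖Complex.exp (-m * y)‖)
      + k * ∫ y in Ioi (0:ℝ), ‖∫ z in Ioi (0:ℝ), gKer m y z * opf U w z‖ := by
    rw [← integral_const_mul, ← integral_add hE.1.norm (hg.2.2.1.norm.const_mul k)]
    refine integral_mono hw.norm (hE.1.norm.add (hg.2.2.1.norm.const_mul k)) fun y => ?_
    simp only
    rw [he y]
    refine (norm_add_le _ _).trans (le_of_eq ?_)
    rw [norm_mul, ibl_norm_Ik hk]
  have h2 : 2 / c ^ 2 * ∫ z in Ioi (0:ℝ), ‖opf U w z‖ ≤ 2 / c ^ 2 * (2 * deltaS U + 2 * N) :=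
    mul_le_mul_of_nonneg_left hf.2 (by positivity)
  have h3 := mul_le_mul_of_nonneg_left (hg.2.2.2.trans h2) hk
  have hN : 0 ≤ N := integral_nonneg fun y => norm_nonneg _
  have h4 : k * (2 / c ^ 2 * (2 * N)) ≤ N / 2 := by
    rw [show k * (2 / c ^ 2 * (2 * N)) = (4 * k * N) / c ^ 2 by ring, div_le_iff₀ (by positivity)]
    nlinarith
  have h5 : k * (2 / c ^ 2 * (2 * deltaS U + 2 * N))
      = 4 * k * deltaS U / c ^ 2 + k * (2 / c ^ 2 * (2 * N)) := by ring
  have h6 : 2 / c = 2 * (1 / c) := by ring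
  have h7 : 8 * k * deltaS U / c ^ 2 = 2 * (4 * k * deltaS U / c ^ 2) := by ring
  rw [h6, h7]
  linarith [hE.2]

lemma isInt_lip {U : ℝ → ℝ} (hU : AdmissibleShearFlow U) {m m' : ℂ} {c : ℝ} (hc : 0 < c)
    (hm : c ≤ m.re) (hm' : c ≤ m'.re) {k : ℝ} (hk : 0 ≤ k) (hkc : 8 * k ≤ c ^ 2) {w w' : ℝ → ℂ}
    (h : IsInt U m k w) (h' : IsInt U m' k w') :
    ∫ y in Ioi (0:ℝ), ‖w y - w' y‖ ≤
      ‖m - m'‖ * (8 / c ^ 2 + 24 * k / c ^ 3 * (2 * deltaS U + 2 * ∫ y in Ioi (0:ℝ), ‖w y‖)) := by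
  obtain ⟨-, hw, he⟩ := h
  obtain ⟨-, hw', he'⟩ := h'
  have hf := opf_int hU hw
  have hd : IntegrableOn (fun x => w x - w' x) (Ioi 0) := hw.sub hw'
  set N := ∫ y in Ioi (0:ℝ), ‖w y‖
  set D := ∫ y in Ioi (0:ℝ), ‖w y - w' y‖
  have hst := opStep_sub hU hc hm' hk hkc hw hw'
  have hsti : IntegrableOn (fun y => opStep U m' k w y - opStep U m' k w' y) (Ioi 0) := (opStep_int hU hc hm' k hw).2.sub (opStep_int hU hc hm' k hw').2
  have hK := ibl_kernel_L1 (fun y z => gKer m y z - gKer m' y z) (3 * ‖m - m'‖ / c ^ 2) (c / 2)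
    (by positivity) (by positivity) ((gKer_cont m).sub (gKer_cont m'))
    (gKer_sub_bound hc hm hm') _ hf.1
  have hX := ibl_dom (f := fun y : ℝ => Complex.exp (-m * y) - Complex.exp (-m' * y))
    ((ibl_cexp_cont m).sub (ibl_cexp_cont m')).aestronglyMeasurable
    ((ibl_exp_Ioi_int (half_pos hc)).const_mul (‖m - m'‖ * (2 / c)))
    (fun y hy => ibl_exp_sub_le hc hm hm' hy.le)
  rw [integral_const_mul, ibl_exp_Ioi (half_pos hc)] at hX
  have hpt : ∀ y, w y - w' y = (Complex.exp (-m * y) - Complex.exp (-m' * y))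
      + (-Complex.I * k) * (∫ z in Ioi (0:ℝ), (gKer m y z - gKer m' y z) * opf U w z)
      + (opStep U m' k w y - opStep U m' k w' y) := by
    intro y
    have i1 := (gKer_op hc hm _ hf.1).1 y
    have i2 := (gKer_op hc hm' _ hf.1).1 y
    have : ∫ z in Ioi (0:ℝ), (gKer m y z - gKer m' y z) * opf U w z
        = (∫ z in Ioi (0:ℝ), gKer m y z * opf U w z)
          - ∫ z in Ioi (0:ℝ), gKer m' y z * opf U w z := by
      rw [← integral_sub i1 i2]
      congr 1; ext z; ring
    rw [this, ← he' y]
    conv_lhs => rw [he y]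
    unfold opStep; ring
  have h1 : D ≤ (∫ y in Ioi (0:ℝ), ‖Complex.exp (-m * y) - Complex.exp (-m' * y)‖)
      + k * (∫ y in Ioi (0:ℝ), ‖∫ z in Ioi (0:ℝ), (gKer m y z - gKer m' y z) * opf U w z‖)
      + ∫ y in Ioi (0:ℝ), ‖opStep U m' k w y - opStep U m' k w' y‖ := by
    have hXK : IntegrableOn (fun y : ℝ => ‖Complex.exp (-m * y) - Complex.exp (-m' * y)‖
        + k * ‖∫ z in Ioi (0:ℝ), (gKer m y z - gKer m' y z) * opf U w z‖) (Ioi 0) :=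
      hX.1.norm.add (hK.2.2.1.norm.const_mul k)
    rw [← integral_const_mul, ← integral_add hX.1.norm (hK.2.2.1.norm.const_mul k),
      ← integral_add hXK hsti.norm]
    refine integral_mono hd.norm (hXK.add hsti.norm) fun y => ?_
    simp only
    rw [hpt y]
    refine (norm_add_le _ _).trans ?_
    refine add_le_add_left ((norm_add_le _ _).trans (le_of_eq ?_)) _
    rw [norm_mul, ibl_norm_Ik hk]
  have h2 := mul_le_mul_of_nonneg_left hf.2
    (show 0 ≤ 2 * (3 * ‖m - m'‖ / c ^ 2) / (c / 2) by positivity)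
  have h3 := mul_le_mul_of_nonneg_left (hK.2.2.2.trans h2) hk
  have e1 : ‖m - m'‖ * (2 / c) * (1 / (c / 2)) = ‖m - m'‖ * (4 / c ^ 2) := by field_simp; norm_num
  have e2 : k * (2 * (3 * ‖m - m'‖ / c ^ 2) / (c / 2) * (2 * deltaS U + 2 * N))
      = ‖m - m'‖ * (12 * k / c ^ 3 * (2 * deltaS U + 2 * N)) := by field_simp; ring
  have e3 : ‖m - m'‖ * (8 / c ^ 2 + 24 * k / c ^ 3 * (2 * deltaS U + 2 * N))
     = 2 * (‖m - m'‖ * (4 / c ^ 2)) + 2 * (‖m - m'‖ * (12 * k / c ^ 3 * (2 * deltaS U + 2 * N))) := by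
    ring
  rw [e3]
  rw [e2] at h3
  rw [e1] at hX
  linarith [hX.2]

/-- The remainder functional. -/
def opE (U : ℝ → ℝ) (m : ℂ) (w : ℝ → ℂ) : ℂ :=
  -(∫ z in Ioi (0:ℝ), Complex.exp (-m * z) * (srcF U z : ℂ))
    + ∫ z in Ioi (0:ℝ), (1 - Complex.exp (-m * z)) * opH U w z

lemma ibl_norm_exp_le_one {m : ℂ} {c : ℝ} (hc : 0 < c) (hm : c ≤ m.re) {s : ℝ} (hs : 0 ≤ s) :
    ‖Complex.exp (-m * s)‖ ≤ 1 :=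
  (ibl_norm_exp_le hm hs).trans (Real.exp_le_one_iff.2 (by nlinarith))

lemma ibl_one_sub {m : ℂ} {c : ℝ} (hc : 0 < c) (hm : c ≤ m.re) {s : ℝ} (hs : 0 ≤ s) :
    ‖1 - Complex.exp (-m * s)‖ ≤ 2 := by
  refine (norm_sub_le _ _).trans ?_
  rw [norm_one]
  linarith [ibl_norm_exp_le_one hc hm hs]

lemma opE_bound {U : ℝ → ℝ} (hU : AdmissibleShearFlow U) {M : ℝ}
    (hM : ∀ y, 0 ≤ y → |srcF U y| ≤ M) {m : ℂ} {c : ℝ} (hc : 0 < c)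
    (hm : c ≤ m.re) {w : ℝ → ℂ} (hw : IntegrableOn w (Ioi 0)) :
    ‖opE U m w‖ ≤ M / c + 4 * ∫ y in Ioi (0:ℝ), ‖w y‖ := by
  have hM0 : 0 ≤ M := (abs_nonneg _).trans (hM 0 le_rfl)
  have hH := opH_int hU hw
  have h1 := ibl_dom (f := fun z : ℝ => Complex.exp (-m * z) * (srcF U z : ℂ))
    ((ibl_cexp_cont m).mul (Complex.continuous_ofReal.comp (ibl_srcF_cont hU))).aestronglyMeasurable
    ((ibl_exp_Ioi_int hc).const_mul M) (fun y hy => by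
      rw [norm_mul, Complex.norm_real, mul_comm]
      exact mul_le_mul (hM y hy.le) (ibl_norm_exp_le hm hy.le) (norm_nonneg _) hM0)
  have h2 := ibl_dom (f := fun z : ℝ => (1 - Complex.exp (-m * z)) * opH U w z)
    ((continuous_const.sub (ibl_cexp_cont m)).aestronglyMeasurable.mul hH.1.aestronglyMeasurable)
    (hH.1.norm.const_mul 2) (fun y hy => by
      rw [norm_mul]
      exact mul_le_mul_of_nonneg_right (ibl_one_sub hc hm hy.le) (norm_nonneg _))
  rw [integral_const_mul] at h1 h2
  rw [ibl_exp_Ioi hc] at h1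
  unfold opE
  refine (norm_add_le _ _).trans ?_
  rw [norm_neg]
  have h3 := (norm_integral_le_integral_norm _).trans h1.2
  have h4 := (norm_integral_le_integral_norm _).trans h2.2
  have : M / c = M * (1 / c) := by ring
  rw [this]
  linarith [hH.2]

lemma opE_lip {U : ℝ → ℝ} (hU : AdmissibleShearFlow U) {M : ℝ}
    (hM : ∀ y, 0 ≤ y → |srcF U y| ≤ M) {m m' : ℂ} {c : ℝ} (hc : 0 < c)
    (hm : c ≤ m.re) (hm' : c ≤ m'.re) {w w' : ℝ → ℂ} (hw : IntegrableOn w (Ioi 0))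
    (hw' : IntegrableOn w' (Ioi 0)) :
    ‖opE U m w - opE U m' w'‖ ≤ ‖m - m'‖ * (4 * M / c ^ 2 + 4 / c * ∫ y in Ioi (0:ℝ), ‖w y‖)
      + 4 * ∫ y in Ioi (0:ℝ), ‖w y - w' y‖ := by
  have hM0 : 0 ≤ M := (abs_nonneg _).trans (hM 0 le_rfl)
  have hH := opH_int hU hw
  have hH' := opH_int hU hw'
  have hd : IntegrableOn (fun x => w x - w' x) (Ioi 0) := hw.sub hw'
  have hHd := opH_int hU hd
  have hcF := Complex.continuous_ofReal.comp (ibl_srcF_cont hU)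
  have A : ∀ {n : ℂ}, c ≤ n.re →
      IntegrableOn (fun z : ℝ => Complex.exp (-n * z) * (srcF U z : ℂ)) (Ioi 0) := fun {n} hn =>
    (ibl_dom (f := fun z : ℝ => Complex.exp (-n * z) * (srcF U z : ℂ))
    ((ibl_cexp_cont n).mul hcF).aestronglyMeasurable
    ((ibl_exp_Ioi_int hc).const_mul M) (fun y hy => by
      rw [norm_mul, mul_comm]
      refine mul_le_mul ?_ (ibl_norm_exp_le hn hy.le) (norm_nonneg _) hM0
      simpa using hM y hy.le)).1
  have B : ∀ {n : ℂ} {v : ℝ → ℂ}, c ≤ n.re → IntegrableOn v (Ioi 0) →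
      IntegrableOn (fun z : ℝ => (1 - Complex.exp (-n * z)) * v z) (Ioi 0) ∧
      ∫ z in Ioi (0:ℝ), ‖(1 - Complex.exp (-n * z)) * v z‖ ≤ 2 * ∫ z in Ioi (0:ℝ), ‖v z‖ :=
    fun {n v} hn hv => by
    rw [← integral_const_mul]
    exact ibl_dom
      ((continuous_const.sub (ibl_cexp_cont n)).aestronglyMeasurable.mul hv.aestronglyMeasurable)
      (hv.norm.const_mul 2) (fun y hy => by
        rw [norm_mul]
        exact mul_le_mul_of_nonneg_right (ibl_one_sub hc hn hy.le) (norm_nonneg _))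
  have h1 := ibl_dom
    (f := fun z : ℝ => (Complex.exp (-m * z) - Complex.exp (-m' * z)) * (srcF U z : ℂ))
    (((ibl_cexp_cont m).sub (ibl_cexp_cont m')).mul hcF).aestronglyMeasurable
    ((ibl_exp_Ioi_int (half_pos hc)).const_mul (M * (‖m - m'‖ * (2 / c)))) (fun y hy => by
      rw [norm_mul, Complex.norm_real, mul_comm, mul_assoc M]
      exact mul_le_mul (hM y hy.le) (ibl_exp_sub_le hc hm hm' hy.le) (norm_nonneg _) hM0)
  have h2 := ibl_dom
    (f := fun z : ℝ => (Complex.exp (-m * z) - Complex.exp (-m' * z)) * opH U w z)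
    (((ibl_cexp_cont m).sub (ibl_cexp_cont m')).aestronglyMeasurable.mul hH.1.aestronglyMeasurable)
    (hH.1.norm.const_mul (‖m - m'‖ * (2 / c))) (fun y hy => by
      rw [norm_mul]
      refine mul_le_mul_of_nonneg_right ?_ (norm_nonneg _)
      refine (ibl_exp_sub_le hc hm hm' hy.le).trans ?_
      have : Real.exp (-(c / 2) * y) ≤ 1 := Real.exp_le_one_iff.2 (by nlinarith)
      exact mul_le_of_le_one_right (by positivity) this)
  have h3 := B hm' hHd.1
  have e : opE U m w - opE U m' w'
      = -(∫ z in Ioi (0:ℝ), (Complex.exp (-m * z) - Complex.exp (-m' * z)) * (srcF U z : ℂ))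
        - (∫ z in Ioi (0:ℝ), (Complex.exp (-m * z) - Complex.exp (-m' * z)) * opH U w z)
        + ∫ z in Ioi (0:ℝ), (1 - Complex.exp (-m' * z)) * opH U (fun x => w x - w' x) z := by
    have e1 : (∫ z in Ioi (0:ℝ), (Complex.exp (-m * z) - Complex.exp (-m' * z)) * (srcF U z : ℂ))
        = (∫ z in Ioi (0:ℝ), Complex.exp (-m * z) * (srcF U z : ℂ))
          - ∫ z in Ioi (0:ℝ), Complex.exp (-m' * z) * (srcF U z : ℂ) := by
      rw [← integral_sub (A hm) (A hm')]
      congr 1; ext z; ring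
    have e2 : (∫ z in Ioi (0:ℝ), (1 - Complex.exp (-m' * z)) * opH U (fun x => w x - w' x) z)
        - (∫ z in Ioi (0:ℝ), (Complex.exp (-m * z) - Complex.exp (-m' * z)) * opH U w z)
        = (∫ z in Ioi (0:ℝ), (1 - Complex.exp (-m * z)) * opH U w z)
          - ∫ z in Ioi (0:ℝ), (1 - Complex.exp (-m' * z)) * opH U w' z := by
      rw [← integral_sub h3.1 h2.1, ← integral_sub (B hm hH.1).1 (B hm' hH'.1).1]
      refine setIntegral_congr_fun measurableSet_Ioi fun z hz => ?_
      rw [opH_sub hw hw' (le_of_lt hz)]; ring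
    unfold opE
    rw [e1]
    linear_combination -e2
  rw [e]
  rw [integral_const_mul] at h1 h2
  rw [ibl_exp_Ioi (half_pos hc)] at h1
  have n1 := (norm_integral_le_integral_norm _).trans h1.2
  have n2 := ((norm_integral_le_integral_norm _).trans h2.2).trans
    (mul_le_mul_of_nonneg_left hH.2 (by positivity))
  have n3 := ((norm_integral_le_integral_norm _).trans h3.2).trans
    (mul_le_mul_of_nonneg_left hHd.2 (by norm_num))
  refine (norm_add_le _ _).trans ?_
  refine (add_le_add_left (norm_sub_le _ _) _).trans ?_
  rw [norm_neg]
  refine (add_le_add (add_le_add n1 n2) n3).trans (le_of_eq ?_)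
  field_simp
  ring


/-! ### The Green function representation and the ODE -/

/-- Exponential-weighted primitive. -/
def wA (m : ℂ) (f : ℝ → ℂ) (y : ℝ) : ℂ := ∫ z in (0:ℝ)..y, Complex.exp (m * z) * f z

/-- Total mass of the forcing against the decaying exponential. -/
def wI (m : ℂ) (f : ℝ → ℂ) : ℂ := ∫ z in Ioi (0:ℝ), Complex.exp (-m * z) * f z

/-- Explicit form of the Green operator. -/
def wW (m : ℂ) (f : ℝ → ℂ) (y : ℝ) : ℂ :=
  (Complex.exp (-m * y) * (wA m f y - wI m f)
    + Complex.exp (m * y) * (wI m f - wA (-m) f y)) / (2 * m)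

/-- Derivative of the explicit form of the Green operator. -/
def wV (m : ℂ) (f : ℝ → ℂ) (y : ℝ) : ℂ :=
  (-(Complex.exp (-m * y) * (wA m f y - wI m f))
    + Complex.exp (m * y) * (wI m f - wA (-m) f y)) / 2

lemma wA_deriv (m : ℂ) {f : ℝ → ℂ} (hf : Continuous f) (y : ℝ) :
    HasDerivAt (wA m f) (Complex.exp (m * y) * f y) y := by
  have hc : Continuous fun z : ℝ => Complex.exp (m * z) * f z := by fun_prop
  exact hc.integral_hasStrictDerivAt 0 y |>.hasDerivAt

lemma ibl_exp_deriv (m : ℂ) (y : ℝ) :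
    HasDerivAt (fun y : ℝ => Complex.exp (m * y)) (m * Complex.exp (m * y)) y := by
  have h : HasDerivAt (fun y : ℝ => m * (y : ℂ)) (m * 1) y :=
    (Complex.ofRealCLM.hasDerivAt (x := y)).const_mul m
  convert h.cexp using 1
  ring

lemma ibl_exp_mul_neg (m : ℂ) (y : ℝ) : Complex.exp (-m * y) * Complex.exp (m * y) = 1 := by
  rw [← Complex.exp_add]; simp

lemma wW_deriv {m : ℂ} (hm : m ≠ 0) {f : ℝ → ℂ} (hf : Continuous f) (y : ℝ) :
    HasDerivAt (wW m f) (wV m f y) y := by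
  have h := (((ibl_exp_deriv (-m) y).mul ((wA_deriv m hf y).sub_const (wI m f))).add
    ((ibl_exp_deriv m y).mul ((wA_deriv (-m) hf y).const_sub (wI m f)))).div_const (2 * m)
  refine h.congr_deriv ?_
  unfold wV
  have := ibl_exp_mul_neg m y
  field_simp
  ring

lemma wV_deriv {m : ℂ} (hm : m ≠ 0) {f : ℝ → ℂ} (hf : Continuous f) (y : ℝ) :
    HasDerivAt (wV m f) (m ^ 2 * wW m f y - f y) y := by
  have h := (((ibl_exp_deriv (-m) y).mul ((wA_deriv m hf y).sub_const (wI m f))).neg.add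
    ((ibl_exp_deriv m y).mul ((wA_deriv (-m) hf y).const_sub (wI m f)))).div_const 2
  refine h.congr_deriv ?_
  unfold wW
  have := ibl_exp_mul_neg m y
  rw [neg_mul] at this ⊢
  field_simp
  linear_combination (-2 * f y) * this

lemma wE_int {m : ℂ} {c : ℝ} (hc : 0 < c) (hm : c ≤ m.re) {f : ℝ → ℂ} 
    (hf : IntegrableOn f (Ioi 0)) :
    IntegrableOn (fun z : ℝ => Complex.exp (-m * z) * f z) (Ioi 0) :=
  (ibl_dom (f := fun z : ℝ => Complex.exp (-m * z) * f z) ((ibl_cexp_cont m).aestronglyMeasurable.mul hf.aestronglyMeasurable) hf.norm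
    (fun y hy => by
      rw [norm_mul]
      exact mul_le_of_le_one_left (norm_nonneg _) (ibl_norm_exp_le_one hc hm hy.le))).1

lemma wI_sub {m : ℂ} {c : ℝ} (hc : 0 < c) (hm : c ≤ m.re) {f : ℝ → ℂ} 
    (hf : IntegrableOn f (Ioi 0)) {y : ℝ} (hy : 0 ≤ y) :
    wI m f - wA (-m) f y = ∫ z in Ioi y, Complex.exp (-m * z) * f z := by
  have h := wE_int hc hm hf
  have := intervalIntegral.integral_Ioi_sub_Ioi h hy
  unfold wI wA
  linear_combination this

lemma wW_eq {m : ℂ} {c : ℝ} (hc : 0 < c) (hm : c ≤ m.re) {f : ℝ → ℂ} (hf : Continuous f)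
    (hfi : IntegrableOn f (Ioi 0)) {y : ℝ} (hy : 0 ≤ y) :
    ∫ z in Ioi (0:ℝ), gKer m y z * f z = wW m f y := by
  have hm0 : m ≠ 0 := by
    rintro rfl; simp at hm; linarith
  have hi := (gKer_op hc hm f hfi).1 y
  have hs := intervalIntegral.integral_Ioi_sub_Ioi hi hy
  have hE := wE_int hc hm hfi
  have c1 : Continuous fun z : ℝ => Complex.exp (m * z) * f z := by fun_prop
  have c2 : Continuous fun z : ℝ => Complex.exp (-m * z) * f z := by fun_prop
  have e1 : ∫ z in (0:ℝ)..y, gKer m y z * f z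
      = Complex.exp (-m * y) / (2 * m) * (wA m f y - wA (-m) f y) := by
    unfold wA
    rw [← intervalIntegral.integral_sub (c1.intervalIntegrable _ _) (c2.intervalIntegrable _ _),
      ← intervalIntegral.integral_const_mul]
    refine intervalIntegral.integral_congr fun z hz => ?_
    rw [uIcc_of_le hy] at hz
    simp only [gKer]
    rw [abs_of_nonneg (sub_nonneg.2 hz.2), abs_of_nonneg hy, abs_of_nonneg hz.1]
    have a1 : Complex.exp (-m * ((y - z : ℝ) : ℂ)) = Complex.exp (-m * y) * Complex.exp (m * z) := by
      rw [← Complex.exp_add]; congr 1; push_cast; ring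
    have a2 : Complex.exp (-m * ((y + z : ℝ) : ℂ)) = Complex.exp (-m * y) * Complex.exp (-m * z) := by
      rw [← Complex.exp_add]; congr 1; push_cast; ring
    rw [a1, a2]
    ring
  have e2 : ∫ z in Ioi y, gKer m y z * f z
      = (Complex.exp (m * y) - Complex.exp (-m * y)) / (2 * m) * (wI m f - wA (-m) f y) := by
    rw [wI_sub hc hm hfi hy, ← integral_const_mul]
    refine setIntegral_congr_fun measurableSet_Ioi fun z hz => ?_
    have hz' : y < z := hz
    simp only [gKer]
    rw [abs_of_nonpos (by linarith), abs_of_nonneg hy, abs_of_nonneg (by linarith)]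
    have a1 : Complex.exp (-m * ((-(y - z) : ℝ) : ℂ)) = Complex.exp (m * y) * Complex.exp (-m * z) := by
      rw [← Complex.exp_add]; congr 1; push_cast; ring
    have a2 : Complex.exp (-m * ((y + z : ℝ) : ℂ)) = Complex.exp (-m * y) * Complex.exp (-m * z) := by
      rw [← Complex.exp_add]; congr 1; push_cast; ring
    rw [a1, a2]
    ring
  rw [e1, e2] at hs
  rw [sub_eq_iff_eq_add.1 hs]
  unfold wW
  ring

lemma ibl_gKer_tendsto {m : ℂ} {c : ℝ} (hc : 0 < c) (hm : c ≤ m.re) {f : ℝ → ℂ}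
    (hfi : IntegrableOn f (Ioi 0)) :
    Tendsto (fun y => ∫ z in Ioi (0:ℝ), gKer m y z * f z) atTop (nhds 0) := by
  have h0 : (0 : ℂ) = ∫ z in Ioi (0:ℝ), (0:ℂ) := by simp
  rw [h0]
  refine tendsto_integral_filter_of_dominated_convergence (fun z => 1 / c * ‖f z‖)
    (Eventually.of_forall fun y => ((gKer_op hc hm f hfi).1 y).aestronglyMeasurable)
    (Eventually.of_forall fun y => Eventually.of_forall fun z => ?_) (hfi.norm.const_mul _)
    (Eventually.of_forall fun z => ?_)
  · rw [norm_mul]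
    refine mul_le_mul_of_nonneg_right ((gKer_bound hc hm y z).trans ?_) (norm_nonneg _)
    refine mul_le_of_le_one_right (by positivity) (Real.exp_le_one_iff.2 ?_)
    have := abs_nonneg (y - z)
    nlinarith
  · have : Tendsto (fun y => 1 / c * Real.exp (-c * |y - z|)) atTop (nhds (1 / c * 0)) := by
      refine Tendsto.const_mul _ (Real.tendsto_exp_atBot.comp ?_)
      refine Tendsto.const_mul_atTop_of_neg (by linarith) ?_
      exact tendsto_abs_atTop_atTop.comp (tendsto_atTop_add_const_right _ (-z) tendsto_id)
    rw [mul_zero] at this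
    have h2 := squeeze_zero_norm (fun y => gKer_bound hc hm y z) this
    simpa using h2.mul_const (f z)

lemma wV_tendsto {m : ℂ} {c : ℝ} (hc : 0 < c) (hm : c ≤ m.re) {f : ℝ → ℂ} (hf : Continuous f)
    (hfi : IntegrableOn f (Ioi 0)) : Tendsto (wV m f) atTop (nhds 0) := by
  have hm0 : m ≠ 0 := by
    rintro rfl; simp at hm; linarith
  have h1 : Tendsto (wW m f) atTop (nhds 0) :=
    (ibl_gKer_tendsto hc hm hfi).congr' (by
      filter_upwards [eventually_ge_atTop 0] with y hy using wW_eq hc hm hf hfi hy)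
  have h2 : Tendsto (fun y : ℝ => Complex.exp (m * y) * (wI m f - wA (-m) f y)) atTop (nhds 0) := by
    have h3 : Tendsto (fun y : ℝ => ∫ z in Ioi y, ‖f z‖) atTop (nhds 0) := by
      have h4 := intervalIntegral_tendsto_integral_Ioi 0 hfi.norm tendsto_id
      have h5 := h4.const_sub (∫ z in Ioi (0:ℝ), ‖f z‖)
      rw [sub_self] at h5
      refine h5.congr' ?_
      filter_upwards [eventually_ge_atTop 0] with y hy
      rw [id, ← intervalIntegral.integral_Ioi_sub_Ioi hfi.norm hy]
      simp
    refine squeeze_zero_norm' ?_ h3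
    filter_upwards [eventually_ge_atTop 0] with y hy
    rw [wI_sub hc hm hfi hy, ← integral_const_mul]
    have hfy : IntegrableOn f (Ioi y) := hfi.mono_set (Ioi_subset_Ioi hy)
    refine norm_integral_le_of_norm_le hfy.norm ?_
    filter_upwards [ae_restrict_mem measurableSet_Ioi] with z hz
    have hz' : y < z := hz
    rw [← mul_assoc, ← Complex.exp_add, norm_mul]
    refine mul_le_of_le_one_left (norm_nonneg _) ?_
    have : m * (y:ℂ) + -m * (z:ℂ) = -m * ((z - y : ℝ) : ℂ) := by push_cast; ring
    rw [this]
    exact ibl_norm_exp_le_one hc hm (by linarith)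
  have h3 := (h1.const_mul (-m)).add h2
  simp only [mul_zero, add_zero] at h3
  refine h3.congr fun y => ?_
  unfold wW wV
  field_simp
  ring

lemma opf_cont {U : ℝ → ℝ} (hU : AdmissibleShearFlow U) {w : ℝ → ℂ} (hw : Continuous w) :
    Continuous (opf U w) := by
  have h1 := ibl_srcF_cont hU
  have h2 := hU.smooth.continuous
  have h3 := ibl_deriv_cont hU
  have h4 : Continuous fun z => ∫ x in (0:ℝ)..z, w x :=
    intervalIntegral.continuous_primitive (fun a b => hw.intervalIntegrable a b) 0
  unfold opf opH
  fun_prop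

lemma wW_integral {m : ℂ} {c : ℝ} (hc : 0 < c) (hm : c ≤ m.re) {f : ℝ → ℂ} (hf : Continuous f)
    (hfi : IntegrableOn f (Ioi 0)) :
    ∫ y in Ioi (0:ℝ), wW m f y = ((∫ y in Ioi (0:ℝ), f y) - wI m f) / m ^ 2 := by
  have hm0 : m ≠ 0 := by
    rintro rfl; simp at hm; linarith
  have hWi : IntegrableOn (wW m f) (Ioi 0) :=
    (gKer_op hc hm f hfi).2.2.1.congr_fun (fun y hy => wW_eq hc hm hf hfi (le_of_lt hy))
      measurableSet_Ioi
  have h := integral_Ioi_of_hasDerivAt_of_tendsto' (fun y _ => wV_deriv hm0 hf y)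
    ((hWi.const_mul (m ^ 2)).sub hfi) (wV_tendsto hc hm hf hfi)
  rw [integral_sub (hWi.const_mul (m ^ 2)) hfi, integral_const_mul] at h
  have h0 : wV m f 0 = wI m f := by simp [wV, wA]
  rw [h0] at h
  field_simp
  linear_combination h

lemma isInt_eq {U : ℝ → ℝ} (hU : AdmissibleShearFlow U) {m : ℂ} {c : ℝ} (hc : 0 < c)
    (hm : c ≤ m.re) {k : ℝ} {w : ℝ → ℂ} (h : IsInt U m k w) {y : ℝ} (hy : 0 ≤ y) :
    w y = Complex.exp (-m * y) + (-Complex.I * k) * wW m (opf U w) y := by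
  rw [h.2.2 y]; unfold opStep
  rw [wW_eq hc hm (opf_cont hU h.1) (opf_int hU h.2.1).1 hy]

lemma isInt_tendsto {U : ℝ → ℝ} (hU : AdmissibleShearFlow U) {m : ℂ} {c : ℝ} (hc : 0 < c)
    (hm : c ≤ m.re) {k : ℝ} {w : ℝ → ℂ} (h : IsInt U m k w) : Tendsto w atTop (nhds 0) := by
  have h1 := ibl_gKer_tendsto hc hm (opf_int hU h.2.1).1
  have h2 : Tendsto (fun y : ℝ => Complex.exp (-m * y)) atTop (nhds 0) := by
    have h3 : Tendsto (fun y : ℝ => Real.exp (-c * y)) atTop (nhds 0) :=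
      Real.tendsto_exp_atBot.comp (Tendsto.const_mul_atTop_of_neg (by linarith) tendsto_id)
    refine squeeze_zero_norm' ?_ h3
    filter_upwards [eventually_ge_atTop 0] with y hy using ibl_norm_exp_le hm hy
  have h3 := h2.add (h1.const_mul (-Complex.I * k))
  simp only [mul_zero, add_zero] at h3
  exact h3.congr fun y => (h.2.2 y).symm

lemma isInt_integral {U : ℝ → ℝ} (hU : AdmissibleShearFlow U) {m : ℂ} {c : ℝ} (hc : 0 < c)
    (hm : c ≤ m.re) {k : ℝ} {w : ℝ → ℂ} (h : IsInt U m k w) :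
    ∫ y in Ioi (0:ℝ), w y = 1 / m + (-Complex.I * k) / m ^ 2 * (2 * deltaS U + opE U m w) := by
  have hm0 : m ≠ 0 := by
    rintro rfl; simp at hm; linarith
  have hf := opf_cont hU h.1
  have hfi := (opf_int hU h.2.1).1
  have hH := (opH_int hU h.2.1).1
  have hF := ibl_srcC_int hU
  have hWi : IntegrableOn (wW m (opf U w)) (Ioi 0) :=
    (gKer_op hc hm _ hfi).2.2.1.congr_fun (fun y hy => wW_eq hc hm hf hfi (le_of_lt hy))
      measurableSet_Ioi
  have e1 : ∫ y in Ioi (0:ℝ), w y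
      = ∫ y in Ioi (0:ℝ), (Complex.exp (-m * y) + (-Complex.I * k) * wW m (opf U w) y) :=
    setIntegral_congr_fun measurableSet_Ioi fun y hy => isInt_eq hU hc hm h (le_of_lt hy)
  have e2 : ∫ y in Ioi (0:ℝ), Complex.exp (-m * y) = 1 / m := by
    rw [integral_exp_mul_complex_Ioi (by simp; linarith)]
    simp
  have e3 : ∫ z in Ioi (0:ℝ), opf U w z = 2 * deltaS U + ∫ z in Ioi (0:ℝ), opH U w z := by
    unfold opf
    rw [integral_add hF hH, integral_complex_ofReal, ibl_srcF_integral hU]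
    push_cast; ring
  have e4 : wI m (opf U w) = (∫ z in Ioi (0:ℝ), Complex.exp (-m * z) * (srcF U z : ℂ))
      + ∫ z in Ioi (0:ℝ), Complex.exp (-m * z) * opH U w z := by
    unfold wI
    rw [← integral_add (wE_int hc hm hF) (wE_int hc hm hH)]
    congr 1; ext z; unfold opf; ring
  have e5 : ∫ z in Ioi (0:ℝ), (1 - Complex.exp (-m * z)) * opH U w z
      = (∫ z in Ioi (0:ℝ), opH U w z) - ∫ z in Ioi (0:ℝ), Complex.exp (-m * z) * opH U w z := by
    rw [← integral_sub hH (wE_int hc hm hH)]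
    congr 1; ext z; ring
  rw [e1, integral_add (ibl_cexp_L1 hc hm).1 (hWi.const_mul _), e2, integral_const_mul,
    wW_integral hc hm hf hfi, e3, e4]
  unfold opE
  rw [e5]
  ring

/-- The half-line ODE solution extracted from the integral equation. -/
lemma isInt_ode {U : ℝ → ℝ} (hU : AdmissibleShearFlow U) {m : ℂ} {c : ℝ} (hc : 0 < c)
    (hm : c ≤ m.re) {k : ℝ} {w : ℝ → ℂ} (h : IsInt U m k w) :
    ∃ f0 f1 f2 : ℝ → ℂ, (∀ y, 0 ≤ y → HasDerivAt f0 (f1 y) y) ∧ (∀ y, 0 ≤ y → HasDerivAt f1 (f2 y) y)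
      ∧ (∀ y, 0 ≤ y → HasDerivAt f2 (m ^ 2 * f1 y + Complex.I * k *
          ((srcF U y : ℂ) + (U y : ℂ) * f1 y - ((deriv U y : ℝ) : ℂ) * f0 y)) y)
      ∧ f0 0 = 0 ∧ f1 0 = 1 ∧ Tendsto f1 atTop (nhds 0)
      ∧ Tendsto f0 atTop (nhds (∫ y in Ioi (0:ℝ), w y)) := by
  have hm0 : m ≠ 0 := by
    rintro rfl; simp at hm; linarith
  have hf := opf_cont hU h.1
  let f1 : ℝ → ℂ := fun y => Complex.exp (-m * y) + (-Complex.I * k) * wW m (opf U w) y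
  let f2 : ℝ → ℂ := fun y => -m * Complex.exp (-m * y) + (-Complex.I * k) * wV m (opf U w) y
  have hd1 : ∀ y, HasDerivAt f1 (f2 y) y := fun y =>
    (ibl_exp_deriv (-m) y).add ((wW_deriv hm0 hf y).const_mul _)
  have hc1 : Continuous f1 := continuous_iff_continuousAt.2 fun y => (hd1 y).continuousAt
  have hw1 : ∀ y, 0 ≤ y → w y = f1 y := fun y hy => isInt_eq hU hc hm h hy
  have hp : ∀ y, 0 ≤ y → ∫ x in (0:ℝ)..y, f1 x = ∫ x in (0:ℝ)..y, w x := fun y hy =>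
    intervalIntegral.integral_congr fun x hx => by
      rw [uIcc_of_le hy] at hx
      exact (hw1 x hx.1).symm
  refine ⟨fun y => ∫ x in (0:ℝ)..y, f1 x, f1, f2, fun y _ => ?_, fun y _ => hd1 y, fun y hy => ?_,
    by simp, ?_, ?_, ?_⟩
  · exact (hc1.integral_hasStrictDerivAt 0 y).hasDerivAt
  · have h2 := ((ibl_exp_deriv (-m) y).const_mul (-m)).add ((wV_deriv hm0 hf y).const_mul (-Complex.I * k))
    refine h2.congr_deriv ?_
    beta_reduce
    rw [hp y hy]
    simp only [opf, opH, hw1 y hy, f1]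
    ring
  · rw [← hw1 0 le_rfl, h.2.2 0]
    unfold opStep
    have : ∀ z : ℝ, gKer m 0 z = 0 := fun z => by simp [gKer]
    simp [this]
  · refine (isInt_tendsto hU hc hm h).congr' ?_
    filter_upwards [eventually_ge_atTop 0] with y hy using hw1 y hy
  · refine (intervalIntegral_tendsto_integral_Ioi 0 h.2.1 tendsto_id).congr' ?_
    filter_upwards [eventually_ge_atTop 0] with y hy using (hp y hy).symm

/-! ### Smooth extension to the whole line -/

lemma ibl_bootstrap {E : Type*} [NormedAddCommGroup E] [NormedSpace ℝ E] {X : E → E}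
    (hX : ContDiff ℝ (⊤ : ℕ∞) X) {v : ℝ → E} {s : Set ℝ} (hs : IsOpen s)
    (hv : ∀ y ∈ s, HasDerivAt v (X (v y)) y) : ContDiffOn ℝ (⊤ : ℕ∞) v s := by
  rw [contDiffOn_infty]
  intro n
  induction n with
  | zero =>
    exact contDiffOn_zero.2 fun y hy => (hv y hy).continuousAt.continuousWithinAt
  | succ n ih =>
    have := (contDiffOn_succ_iff_deriv_of_isOpen (n := (n : WithTop ℕ∞)) (f := v) hs).2
      ⟨fun y hy => (hv y hy).differentiableAt.differentiableWithinAt, by simp, ?_⟩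
    · exact_mod_cast this
    · have h1 : ContDiff ℝ (n : WithTop ℕ∞) X := hX.of_le (by exact_mod_cast le_top)
      exact (h1.comp_contDiffOn ih).congr fun y hy => (hv y hy).deriv

lemma ibl_extend {E : Type*} [NormedAddCommGroup E] [NormedSpace ℝ E] [CompleteSpace E] {X : E → E}
    (hX : ContDiff ℝ (⊤ : ℕ∞) X) {r : ℝ → E} (hr : ∀ y, 0 ≤ y → HasDerivAt r (X (r y)) y) :
    ∃ δ > (0:ℝ), ∃ v : ℝ → E, (∀ y, 0 ≤ y → v y = r y) ∧
      (∀ y, -δ < y → HasDerivAt v (X (v y)) y) := by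
  have hX1 : ContDiffAt ℝ 1 X (r 0) := (hX.of_le (by exact_mod_cast le_top)).contDiffAt
  obtain ⟨l, hl0, δ, hδ, hl⟩ :=
    hX1.exists_forall_mem_closedBall_exists_eq_forall_mem_Ioo_hasDerivAt₀ 0
  refine ⟨δ, hδ, fun y => if 0 ≤ y then r y else l y, fun y hy => if_pos hy, fun y hy => ?_⟩
  rcases lt_trichotomy y 0 with h | h | h
  · have e : (fun y => if 0 ≤ y then r y else l y) =ᶠ[nhds y] l := by
      filter_upwards [Iio_mem_nhds h] with x hx
      exact if_neg (not_le.2 hx)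
    beta_reduce
    rw [if_neg (not_le.2 h)]
    exact (hl y ⟨by linarith, by linarith⟩).congr_of_eventuallyEq e
  · subst h
    beta_reduce
    rw [if_pos le_rfl]
    have h1 : HasDerivWithinAt (fun y => if 0 ≤ y then r y else l y) (X (r 0)) (Ici 0) 0 :=
      (hr 0 le_rfl).hasDerivWithinAt.congr (fun x hx => if_pos hx) (if_pos le_rfl)
    have h2 : HasDerivWithinAt (fun y => if 0 ≤ y then r y else l y) (X (r 0)) (Iic 0) 0 := by
      have h3 := hl 0 ⟨by linarith, by linarith⟩
      rw [hl0] at h3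
      refine h3.hasDerivWithinAt.congr (fun x hx => ?_) ?_
      · rcases eq_or_lt_of_le (show x ≤ 0 from hx) with h | h
        · subst h; simp [hl0]
        · exact if_neg (not_le.2 h)
      · simp [hl0]
    have := h1.union h2
    rwa [Ici_union_Iic, hasDerivWithinAt_univ] at this
  · have e : (fun y => if 0 ≤ y then r y else l y) =ᶠ[nhds y] r := by
      filter_upwards [Ioi_mem_nhds h] with x hx
      exact if_pos (le_of_lt hx)
    beta_reduce
    rw [if_pos h.le]
    exact (hr y h.le).congr_of_eventuallyEq e

/-- A smooth function on a neighbourhood of the half line agrees with a globally smooth one. -/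
lemma ibl_cutoff {f : ℝ → ℂ} {δ : ℝ} (hδ : 0 < δ) (hf : ContDiffOn ℝ (⊤ : ℕ∞) f (Ioi (-δ))) :
    ∃ φ : ℝ → ℂ, ContDiff ℝ (⊤ : ℕ∞) φ ∧ ∀ y, -(δ / 3) < y → φ y = f y := by
  refine ⟨fun y => (Real.smoothTransition (2 + 3 * y / δ) : ℂ) * f y, ?_, fun y hy => ?_⟩
  · rw [contDiff_iff_contDiffAt]
    intro y
    by_cases h : -δ < y
    · have h1 : ContDiffAt ℝ (⊤ : ℕ∞) f y := hf.contDiffAt (Ioi_mem_nhds h)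
      have h2 : ContDiff ℝ (⊤ : ℕ∞) fun y : ℝ => (Real.smoothTransition (2 + 3 * y / δ) : ℂ) := by
        refine Complex.ofRealCLM.contDiff.comp (Real.smoothTransition.contDiff.comp ?_)
        fun_prop
      exact h2.contDiffAt.mul h1
    · have e : (fun y => (Real.smoothTransition (2 + 3 * y / δ) : ℂ) * f y) =ᶠ[nhds y]
          fun _ => 0 := by
        filter_upwards [Iio_mem_nhds (show y < -(2 * δ / 3) by linarith)] with x hx
        have hx' : x < -(2 * δ / 3) := hx
        rw [Real.smoothTransition.zero_of_nonpos]
        · simp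
        · have : 3 * x / δ ≤ -2 := by
            rw [div_le_iff₀ hδ]; linarith
          linarith
      exact contDiffAt_const.congr_of_eventuallyEq e
  · beta_reduce
    rw [Real.smoothTransition.one_of_one_le]
    · simp
    · have : -1 ≤ 3 * y / δ := by
        rw [le_div_iff₀ hδ]; linarith
      linarith

/-- The vector field of the autonomous first order system. -/
def vecX (U : ℝ → ℝ) (m : ℂ) (k : ℝ) (p : ℝ × ℂ × ℂ × ℂ) : ℝ × ℂ × ℂ × ℂ :=
  (1, p.2.2.1, p.2.2.2, m ^ 2 * p.2.2.1 + Complex.I * k *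
    ((srcF U p.1 : ℂ) + (U p.1 : ℂ) * p.2.2.1 - ((deriv U p.1 : ℝ) : ℂ) * p.2.1))

lemma vecX_smooth {U : ℝ → ℝ} (hU : AdmissibleShearFlow U) (m : ℂ) (k : ℝ) :
    ContDiff ℝ (⊤ : ℕ∞) (vecX U m k) := by
  have h1 : ContDiff ℝ (⊤ : ℕ∞) U := hU.smooth
  have h2 : ContDiff ℝ (⊤ : ℕ∞) (deriv U) := ContDiff.deriv' (by simpa using h1)
  have h3 : ContDiff ℝ (⊤ : ℕ∞) (srcF U) := by
    unfold srcF
    exact (contDiff_const.sub h1).add (contDiff_id.mul h2)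
  have g1 : ContDiff ℝ (⊤ : ℕ∞) fun y : ℝ => (U y : ℂ) := Complex.ofRealCLM.contDiff.comp h1
  have g2 : ContDiff ℝ (⊤ : ℕ∞) fun y : ℝ => ((deriv U y : ℝ) : ℂ) :=
    Complex.ofRealCLM.contDiff.comp h2
  have g3 : ContDiff ℝ (⊤ : ℕ∞) fun y : ℝ => (srcF U y : ℂ) := Complex.ofRealCLM.contDiff.comp h3
  have q1 : ContDiff ℝ (⊤ : ℕ∞) fun p : ℝ × ℂ × ℂ × ℂ => (U p.1 : ℂ) := g1.comp contDiff_fst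
  have q2 : ContDiff ℝ (⊤ : ℕ∞) fun p : ℝ × ℂ × ℂ × ℂ => ((deriv U p.1 : ℝ) : ℂ) :=
    g2.comp contDiff_fst
  have q3 : ContDiff ℝ (⊤ : ℕ∞) fun p : ℝ × ℂ × ℂ × ℂ => (srcF U p.1 : ℂ) := g3.comp contDiff_fst
  have p1 : ContDiff ℝ (⊤ : ℕ∞) fun p : ℝ × ℂ × ℂ × ℂ => p.2.1 := contDiff_fst.comp contDiff_snd
  have p2 : ContDiff ℝ (⊤ : ℕ∞) fun p : ℝ × ℂ × ℂ × ℂ => p.2.2.1 :=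
    contDiff_fst.comp (contDiff_snd.comp contDiff_snd)
  have p3 : ContDiff ℝ (⊤ : ℕ∞) fun p : ℝ × ℂ × ℂ × ℂ => p.2.2.2 :=
    contDiff_snd.comp (contDiff_snd.comp contDiff_snd)
  exact contDiff_const.prodMk (p2.prodMk (p3.prodMk ((contDiff_const.mul p2).add
    (contDiff_const.mul ((q3.add (q1.mul p2)).sub (q2.mul p1))))))

/-- A solution of the integral equation gives a smooth eigenmode. -/
lemma isInt_eig {U : ℝ → ℝ} (hU : AdmissibleShearFlow U) {m : ℂ} {c : ℝ} (hc : 0 < c)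
    (hm : c ≤ m.re) {k : ℝ} (hk : 0 < k) {w : ℝ → ℂ} (h : IsInt U m k w) :
    ∃ φ, IsEigSolution U (Complex.I * m ^ 2 / k) k (∫ y in Ioi (0:ℝ), w y) φ := by
  obtain ⟨f0, f1, f2, d0, d1, d2, z0, z1, l1, l0⟩ := isInt_ode hU hc hm h
  have hX := vecX_smooth hU m k
  obtain ⟨δ, hδ, v, hvr, hv⟩ := ibl_extend hX (r := fun y => (y, f0 y, f1 y, f2 y))
    (fun y hy => (hasDerivAt_id y).prodMk ((d0 y hy).prodMk ((d1 y hy).prodMk (d2 y hy))))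
  have hvs := ibl_bootstrap hX isOpen_Ioi (s := Ioi (-δ)) hv
  let g0 : ℝ → ℂ := fun y => (v y).2.1
  let g1 : ℝ → ℂ := fun y => (v y).2.2.1
  let g2 : ℝ → ℂ := fun y => (v y).2.2.2
  have hd : ∀ y, -δ < y → HasDerivAt g0 (g1 y) y ∧ HasDerivAt g1 (g2 y) y ∧
      HasDerivAt g2 (vecX U m k (v y)).2.2.2 y := by
    intro y hy
    have h := hv y hy
    have hs : HasDerivAt (fun y => (v y).2) (vecX U m k (v y)).2 y := h.snd
    have hss : HasDerivAt (fun y => (v y).2.2) (vecX U m k (v y)).2.2 y := hs.snd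
    exact ⟨hs.fst, hss.fst, hss.snd⟩
  have hg0 : ContDiffOn ℝ (⊤ : ℕ∞) g0 (Ioi (-δ)) := hvs.snd.fst
  obtain ⟨φ, hφ, hφg⟩ := ibl_cutoff hδ hg0
  have e0 : ∀ y, 0 ≤ y → φ =ᶠ[nhds y] g0 := fun y hy => by
    filter_upwards [Ioi_mem_nhds (show -(δ / 3) < y by linarith)] with x hx using hφg x hx
  have en : ∀ y, 0 ≤ y → ∀ᶠ x in nhds y, -δ < x := fun y hy =>
    Ioi_mem_nhds (show -δ < y by linarith)
  have e1 : ∀ y, 0 ≤ y → deriv φ =ᶠ[nhds y] g1 := fun y hy => by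
    refine (e0 y hy).deriv.trans ?_
    filter_upwards [en y hy] with x hx using (hd x hx).1.deriv
  have e2 : ∀ y, 0 ≤ y → deriv (deriv φ) =ᶠ[nhds y] g2 := fun y hy => by
    refine (e1 y hy).deriv.trans ?_
    filter_upwards [en y hy] with x hx using (hd x hx).2.1.deriv
  have e3 : ∀ y, 0 ≤ y → deriv (deriv (deriv φ)) y = (vecX U m k (v y)).2.2.2 := fun y hy => by
    rw [(e2 y hy).deriv_eq]
    exact (hd y (by linarith)).2.2.deriv
  have v0 : ∀ y, 0 ≤ y → φ y = f0 y := fun y hy => by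
    rw [(e0 y hy).eq_of_nhds]; simp only [g0, hvr y hy]
  have v1 : ∀ y, 0 ≤ y → deriv φ y = f1 y := fun y hy => by
    rw [(e1 y hy).eq_of_nhds]; simp only [g1, hvr y hy]
  refine ⟨φ, hφ, fun y hy => ?_, ?_, ?_, ?_, ?_⟩
  · have : iteratedDeriv 3 φ y = deriv (deriv (deriv φ)) y := by
      simp [iteratedDeriv_succ, iteratedDeriv_zero]
    rw [this, e3 y hy, hvr y hy, v0 y hy, v1 y hy]
    simp only [vecX]
    have hk0 : (k : ℂ) ≠ 0 := by exact_mod_cast hk.ne'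
    have hI := Complex.I_sq
    field_simp
    linear_combination (-(k:ℂ) * ((srcF U y : ℂ) + (U y : ℂ) * f1 y
      - ((deriv U y : ℝ) : ℂ) * f0 y)) * hI
  · rw [v0 0 le_rfl, z0]
  · rw [v1 0 le_rfl, z1]
  · refine l1.congr' ?_
    filter_upwards [eventually_ge_atTop 0] with y hy using (v1 y hy).symm
  · refine l0.congr' ?_
    filter_upwards [eventually_ge_atTop 0] with y hy using (v0 y hy).symm

/-! ### The dispersion relation -/

lemma ibl_newton {d ε : ℝ} (hd : 0 < d) (hε : 0 ≤ ε) (hε1 : ε ≤ d / 16) (e : ℂ → ℂ)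
    (he : ∀ n : ℂ, d / 2 ≤ n.re → ‖e n‖ ≤ ε * d / 4)
    (hL : ∀ n n' : ℂ, d / 2 ≤ n.re → d / 2 ≤ n'.re → ‖e n - e n'‖ ≤ ε * ‖n - n'‖) :
    ∃ n : ℂ, 3 * d / 4 ≤ n.re ∧ n ^ 2 = ε * n - Complex.I * (2 * d ^ 2 + e n) := by
  set n0 : ℂ := d * (1 - Complex.I) with hn0
  have hre : n0.re = d := by simp [hn0]
  have hlow : d ≤ ‖n0‖ := by
    have := Complex.re_le_norm n0; rwa [hre] at this
  have hup : ‖n0‖ ≤ 2 * d := by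
    rw [hn0, norm_mul, Complex.norm_real, Real.norm_of_nonneg hd.le]
    have : ‖(1 - Complex.I : ℂ)‖ ≤ 2 := by
      refine (norm_sub_le _ _).trans ?_
      simp; norm_num
    nlinarith
  have hn00 : n0 ≠ 0 := norm_pos_iff.1 (hd.trans_le hlow)
  have hsq : n0 ^ 2 = -(2 * Complex.I * d ^ 2) := by
    rw [hn0, mul_pow]
    linear_combination (d : ℂ) ^ 2 * Complex.I_sq
  let T : ℂ → ℂ := fun n => n0 + (ε * n - Complex.I * e n - (n - n0) ^ 2) / (2 * n0)
  let B : Set ℂ := Metric.closedBall n0 (d / 4)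
  have hB : ∀ n ∈ B, ‖n - n0‖ ≤ d / 4 := fun n hn => mem_closedBall_iff_norm.1 hn
  have hBre : ∀ n ∈ B, 3 * d / 4 ≤ n.re := by
    intro n hn
    have h1 := (Complex.abs_re_le_norm (n - n0)).trans (hB n hn)
    rw [Complex.sub_re, hre] at h1
    have := (abs_le.1 h1).1
    linarith
  have hBre' : ∀ n ∈ B, d / 2 ≤ n.re := fun n hn => by linarith [hBre n hn]
  have hdiv : ∀ (x : ℂ) (r : ℝ), ‖x‖ ≤ 2 * d * r → ‖x / (2 * n0)‖ ≤ r := by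
    intro x r hx
    have hr : 0 ≤ r := by
      by_contra h
      have := norm_nonneg x
      nlinarith
    rw [norm_div, norm_mul, Complex.norm_two, div_le_iff₀ (by linarith)]
    nlinarith
  have hmaps : MapsTo T B B := by
    intro n hn
    refine mem_closedBall_iff_norm.2 ?_
    simp only [T, add_sub_cancel_left]
    refine hdiv _ _ ?_
    have h1 := hB n hn
    have h2 : ‖n‖ ≤ 3 * d := by
      have := norm_add_le (n - n0) n0
      rw [sub_add_cancel] at this
      linarith
    have h3 := he n (hBre' n hn)
    have h4 : ‖(ε * n - Complex.I * e n - (n - n0) ^ 2 : ℂ)‖ ≤ ε * ‖n‖ + ‖e n‖ + ‖n - n0‖ ^ 2 := by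
      refine (norm_sub_le _ _).trans ?_
      rw [norm_pow]
      refine add_le_add_left ((norm_sub_le _ _).trans ?_) _
      rw [norm_mul, norm_mul, Complex.norm_real, Real.norm_of_nonneg hε, Complex.norm_I, one_mul]
    have h5 : ‖n - n0‖ ^ 2 ≤ (d / 4) ^ 2 := pow_le_pow_left₀ (norm_nonneg _) h1 2
    have h6 := mul_le_mul_of_nonneg_left h2 hε
    nlinarith
  have hcon : ContractingWith (1 / 2) (hmaps.restrict T B B) := by
    refine ⟨by rw [← NNReal.coe_lt_coe]; norm_num, LipschitzWith.of_dist_le_mul fun a b => ?_⟩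
    obtain ⟨a, ha⟩ := a
    obtain ⟨b, hb⟩ := b
    change dist (T a) (T b) ≤ _ * dist a b
    rw [dist_eq_norm, dist_eq_norm]
    have e1 : T a - T b = (ε * (a - b) - Complex.I * (e a - e b)
        - (a - b) * ((a - n0) + (b - n0))) / (2 * n0) := by
      simp only [T]; ring
    rw [e1]
    refine hdiv _ _ ?_
    have h1 := hL a b (hBre' a ha) (hBre' b hb)
    have h2 : ‖(a - n0) + (b - n0)‖ ≤ d / 2 :=
      (norm_add_le _ _).trans (by linarith [hB a ha, hB b hb])
    have h4 : ‖(ε * (a - b) - Complex.I * (e a - e b) - (a - b) * ((a - n0) + (b - n0)) : ℂ)‖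
        ≤ ε * ‖a - b‖ + ‖e a - e b‖ + ‖a - b‖ * ‖(a - n0) + (b - n0)‖ := by
      refine (norm_sub_le _ _).trans ?_
      rw [norm_mul (a - b)]
      refine add_le_add_left ((norm_sub_le _ _).trans ?_) _
      rw [norm_mul, norm_mul, Complex.norm_real, Real.norm_of_nonneg hε, Complex.norm_I, one_mul]
    have h5 := mul_le_mul_of_nonneg_left h2 (norm_nonneg (a - b))
    have h6 := mul_le_mul_of_nonneg_right hε1 (norm_nonneg (a - b))
    have h7 := mul_nonneg hd.le (norm_nonneg (a - b))
    have : ((1 / 2 : NNReal) : ℝ) = 1 / 2 := by norm_num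
    rw [this]
    nlinarith
  obtain ⟨n, hnB, hfix, -⟩ := ContractingWith.exists_fixedPoint' Metric.isClosed_closedBall.isComplete
    hmaps hcon (x := n0) (Metric.mem_closedBall_self (by positivity)) (edist_ne_top _ _)
  refine ⟨n, hBre n hnB, ?_⟩
  have hT : n0 + (ε * n - Complex.I * e n - (n - n0) ^ 2) / (2 * n0) = n := hfix
  have h2 : (ε * n - Complex.I * e n - (n - n0) ^ 2) = (n - n0) * (2 * n0) := by
    rw [← eq_sub_iff_add_eq'] at hT
    exact (div_eq_iff (mul_ne_zero two_ne_zero hn00)).1 hT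
  linear_combination -h2 + hsq

/-- Constants in the a priori bounds. -/
lemma ibl_consts {d M : ℝ} (hd : 0 < d) (hM : 0 ≤ M) :
    ∃ C2 C3 : ℝ, 0 ≤ C2 ∧ 0 ≤ C3 ∧ ∀ (U : ℝ → ℝ), AdmissibleShearFlow U →
      deltaS U = d ^ 2 → (∀ y, 0 ≤ y → |srcF U y| ≤ M) →
      ∀ ε k τ : ℝ, 0 < ε → ε ≤ 1 → 0 < k → τ = 1 / (ε ^ 2 * k) → τ ≤ 1 → τ ≤ d ^ 2 / 32 →
      8 * k ≤ (ε * k * d / 2) ^ 2 ∧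
      ∀ n n' : ℂ, d / 2 ≤ n.re → d / 2 ≤ n'.re → ∀ w w' : ℝ → ℂ,
        IsInt U (ε * k * n) k w → IsInt U (ε * k * n') k w' →
        ‖opE U (ε * k * n) w‖ ≤ C2 * τ ∧
        ‖opE U (ε * k * n) w - opE U (ε * k * n') w'‖ ≤ C3 * τ * ‖n - n'‖ := by
  refine ⟨2 * M / d + 4 * (4 / d + 32), 16 * M / d ^ 2 + 8 / d * (4 / d + 32) + 128 / d ^ 2
    + 768 / d ^ 3 * (2 * d ^ 2 + 2 * (4 / d + 32)), by positivity, by positivity, ?_⟩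
  intro U hU hΔ hMb ε k τ hε hε1 hk hτ hτ1 hτd
  set C1 := 4 / d + 32 with hC1
  have hC1p : 0 < C1 := by positivity
  have hτp : 0 < τ := by rw [hτ]; positivity
  have hkc : 8 * k ≤ (ε * k * d / 2) ^ 2 := by
    rw [hτ, div_le_div_iff₀ (by positivity) (by norm_num)] at hτd
    nlinarith
  refine ⟨hkc, fun n n' hn hn' w w' hw hw' => ?_⟩
  set c := ε * k * d / 2 with hc
  have hcp : 0 < c := by positivity
  have hre : ∀ z : ℂ, d / 2 ≤ z.re → c ≤ ((ε : ℂ) * k * z).re := by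
    intro z hz
    have : ((ε : ℂ) * k * z).re = ε * k * z.re := by
      rw [← Complex.ofReal_mul, Complex.re_ofReal_mul]
    rw [this, hc]
    have := mul_le_mul_of_nonneg_left hz (by positivity : 0 ≤ ε * k)
    linarith
  have hm := hre n hn
  have hm' := hre n' hn'
  have hN := isInt_norm hU hcp hm hk.le hkc hw
  have hE := opE_bound hU hMb hcp hm hw.2.1
  have hLw := isInt_lip hU hcp hm hm' hk.le hkc hw hw'
  have hLe := opE_lip hU hMb hcp hm hm' hw.2.1 hw'.2.1
  set N := ∫ y in Ioi (0:ℝ), ‖w y‖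
  set D := ∫ y in Ioi (0:ℝ), ‖w y - w' y‖
  have hN0 : 0 ≤ N := integral_nonneg fun y => norm_nonneg _
  -- elementary relations
  have r1 : 1 / (ε * k) ≤ τ := by
    rw [hτ]
    refine one_div_le_one_div_of_le (by positivity) ?_
    nlinarith [mul_pos hε hk]
  have r2 : 1 / c = 2 / d * (1 / (ε * k)) := by rw [hc]; field_simp
  have r3 : 1 / c ≤ 2 / d * τ := by
    rw [r2]; exact mul_le_mul_of_nonneg_left r1 (by positivity)
  have r4 : k / c ^ 2 = 4 / d ^ 2 * τ := by rw [hc, hτ]; field_simp; norm_num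
  have hN1 : N ≤ C1 * τ := by
    have a : 2 / c + 8 * k * deltaS U / c ^ 2 = 2 * (1 / c) + 8 * d ^ 2 * (k / c ^ 2) := by
      rw [hΔ]; ring
    have b : 8 * d ^ 2 * (4 / d ^ 2 * τ) = 32 * τ := by field_simp; norm_num
    rw [a, r4, b] at hN
    have : C1 * τ = 2 * (2 / d * τ) + 32 * τ := by rw [hC1]; ring
    linarith
  have hN2 : N ≤ C1 := hN1.trans (mul_le_of_le_one_right hC1p.le hτ1)
  constructor
  · refine hE.trans ?_
    have a : M / c = M * (1 / c) := by ring
    have b := mul_le_mul_of_nonneg_left r3 hM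
    have : (2 * M / d + 4 * C1) * τ = M * (2 / d * τ) + 4 * (C1 * τ) := by ring
    rw [a, this]; linarith
  · set t := ‖n - n'‖ with ht
    have ht0 : 0 ≤ t := norm_nonneg _
    have hmm : ‖(ε : ℂ) * k * n - ε * k * n'‖ = ε * k * t := by
      rw [← mul_sub, norm_mul, norm_mul, Complex.norm_real, Complex.norm_real,
        Real.norm_of_nonneg hε.le, Real.norm_of_nonneg hk.le]
    rw [hmm] at hLw hLe
    rw [hΔ] at hLw
    have s1 : ε * k * (1 / c ^ 2) ≤ 4 / d ^ 2 * τ := by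
      have : ε * k * (1 / c ^ 2) = 4 / d ^ 2 * (1 / (ε * k)) := by rw [hc]; field_simp; norm_num
      rw [this]; exact mul_le_mul_of_nonneg_left r1 (by positivity)
    have s2 : ε * k * (1 / c) = 2 / d := by rw [hc]; field_simp
    have s3 : ε * k * (k / c ^ 3) = 8 / d ^ 3 * τ := by rw [hc, hτ]; field_simp; norm_num
    have q1 : ε * k * t * (4 * M / c ^ 2 + 4 / c * N)
        = t * (4 * M * (ε * k * (1 / c ^ 2)) + 4 * N * (ε * k * (1 / c))) := by ring
    have q2 : ε * k * t * (8 / c ^ 2 + 24 * k / c ^ 3 * (2 * d ^ 2 + 2 * N))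
        = t * (8 * (ε * k * (1 / c ^ 2)) + 24 * (2 * d ^ 2 + 2 * N) * (ε * k * (k / c ^ 3))) := by
      ring
    rw [q1, s2] at hLe
    rw [q2, s3] at hLw
    have p1 : 4 * M * (ε * k * (1 / c ^ 2)) + 4 * N * (2 / d)
        ≤ 4 * M * (4 / d ^ 2 * τ) + 4 * (C1 * τ) * (2 / d) := by gcongr
    have p2 : 8 * (ε * k * (1 / c ^ 2)) + 24 * (2 * d ^ 2 + 2 * N) * (8 / d ^ 3 * τ)
        ≤ 8 * (4 / d ^ 2 * τ) + 24 * (2 * d ^ 2 + 2 * C1) * (8 / d ^ 3 * τ) := by gcongr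
    have p1' := mul_le_mul_of_nonneg_left p1 ht0
    have p2' := mul_le_mul_of_nonneg_left p2 ht0
    have fin : (16 * M / d ^ 2 + 8 / d * C1 + 128 / d ^ 2
        + 768 / d ^ 3 * (2 * d ^ 2 + 2 * C1)) * τ * t
        = t * (4 * M * (4 / d ^ 2 * τ) + 4 * (C1 * τ) * (2 / d))
          + 4 * (t * (8 * (4 / d ^ 2 * τ) + 24 * (2 * d ^ 2 + 2 * C1) * (8 / d ^ 3 * τ))) := by
      ring
    rw [fin]
    linarith

/-- Theorem (strong unconditional viscosity-induced instability for IBL). -/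
theorem ibl_strong_instability (U : ℝ → ℝ) (hU : AdmissibleShearFlow U) :
    ∃ νb K S η : ℝ, 0 < νb ∧ 0 < K ∧ 0 < S ∧ 0 < η ∧
      ∀ ν : ℝ, 0 < ν → ν ≤ νb → ∀ k : ℕ, K ≤ (k : ℝ) →
        S ≤ (k : ℝ) * ν ^ ((3:ℝ)/4) →
        ∃ μ : ℂ, η * ν ^ ((3:ℝ)/4) * (k : ℝ) ≤ μ.im ∧ ∃ φ : ℝ → ℂ,
          IsEigSolution U μ (k : ℝ) ((((Real.sqrt ν * (k : ℝ))⁻¹ : ℝ)) : ℂ) φ := by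
  have hΔ := ibl_delta_pos hU
  obtain ⟨M, hM, hMb⟩ := ibl_srcF_bdd hU
  set d := Real.sqrt (deltaS U) with hd
  have hdp : 0 < d := Real.sqrt_pos.2 hΔ
  have hd2 : deltaS U = d ^ 2 := (Real.sq_sqrt hΔ.le).symm
  obtain ⟨C2, C3, hC2, hC3, H⟩ := ibl_consts hdp hM
  set ε0 := min 1 (min (d / 16) (d ^ 2 / 32)) with hε0
  have hεpos0 : 0 < ε0 := by positivity
  have hS : 0 < 1 + 4 * C2 / d + C3 := by positivity
  refine ⟨ε0 ^ 4, 1, 1 + 4 * C2 / d + C3, d / 2, by positivity, one_pos, hS, by positivity, ?_⟩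
  intro ν hν hνb k hk1 hkS
  set κ : ℝ := (k : ℝ) with hκ
  have hκp : 0 < κ := by linarith
  set ε := ν ^ ((1:ℝ)/4) with hε
  have hεp : 0 < ε := Real.rpow_pos_of_pos hν _
  have hε4 : ε ^ 4 = ν := by
    rw [hε, ← Real.rpow_natCast, ← Real.rpow_mul hν.le]; norm_num
  have hε3 : ν ^ ((3:ℝ)/4) = ε ^ 3 := by
    rw [hε, ← Real.rpow_natCast, ← Real.rpow_mul hν.le]; norm_num
  have hε2 : Real.sqrt ν = ε ^ 2 := by
    rw [← hε4, show ε ^ 4 = (ε ^ 2) ^ 2 by ring, Real.sqrt_sq (by positivity)]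
  have hεle : ε ≤ ε0 := by
    rw [← hε4] at hνb
    exact le_of_pow_le_pow_left₀ (by norm_num) hεpos0.le hνb
  have b1 : ε ≤ 1 := hεle.trans (min_le_left _ _)
  have b2 : ε ≤ d / 16 := hεle.trans ((min_le_right _ _).trans (min_le_left _ _))
  have b3 : ε ≤ d ^ 2 / 32 := hεle.trans ((min_le_right _ _).trans (min_le_right _ _))
  rw [hε3] at hkS ⊢
  rw [hε2]
  set τ := 1 / (ε ^ 2 * κ) with hτ
  have hτp : 0 < τ := by positivity
  have hτS : τ * (1 + 4 * C2 / d + C3) ≤ ε := by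
    have h1 := mul_le_mul_of_nonneg_left hkS hτp.le
    have h2 : τ * (κ * ε ^ 3) = ε := by rw [hτ]; field_simp
    rwa [h2] at h1
  have hx1 : 0 ≤ τ * (4 * C2 / d) := by positivity
  have hx2 : 0 ≤ τ * C3 := by positivity
  have hτε : τ ≤ ε := by linarith
  have hC2τ : C2 * τ ≤ ε * d / 4 := by
    have : τ * (4 * C2 / d) ≤ ε := by linarith
    have h1 := mul_le_mul_of_nonneg_right this hdp.le
    have h2 : τ * (4 * C2 / d) * d = 4 * (C2 * τ) := by field_simp
    linarith
  have hC3τ : C3 * τ ≤ ε := by linarith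
  obtain ⟨hkc, HH⟩ := H U hU hd2 hMb ε κ τ hεp b1 hκp hτ (hτε.trans b1) (hτε.trans b3)
  have hcp : 0 < ε * κ * d / 2 := by positivity
  have hre : ∀ z : ℂ, d / 2 ≤ z.re → ε * κ * d / 2 ≤ ((ε : ℂ) * κ * z).re := by
    intro z hz
    have : ((ε : ℂ) * κ * z).re = ε * κ * z.re := by
      rw [← Complex.ofReal_mul, Complex.re_ofReal_mul]
    rw [this]
    have := mul_le_mul_of_nonneg_left hz (by positivity : 0 ≤ ε * κ)
    linarith
  have hex : ∀ n : ℂ, ∃ w : ℝ → ℂ, d / 2 ≤ n.re → IsInt U (ε * κ * n) κ w := by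
    intro n
    by_cases hn : d / 2 ≤ n.re
    · obtain ⟨w, hw⟩ := isInt_exists hU hcp (hre n hn) hκp.le hkc
      exact ⟨w, fun _ => hw⟩
    · exact ⟨0, fun h => absurd h hn⟩
  choose W hW using hex
  obtain ⟨n, hn, hneq⟩ := ibl_newton hdp hεp.le b2 (fun n => opE U (ε * κ * n) (W n))
    (fun n hn => ((HH n n hn hn _ _ (hW n hn) (hW n hn)).1).trans hC2τ)
    (fun n n' hn hn' => ((HH n n' hn hn' _ _ (hW n hn) (hW n' hn')).2).trans
      (mul_le_mul_of_nonneg_right hC3τ (norm_nonneg _)))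
  have hn' : d / 2 ≤ n.re := by linarith
  have hw := hW n hn'
  have heb := ((HH n n hn' hn' _ _ hw hw).1).trans hC2τ
  set e := opE U (ε * κ * n) (W n) with he
  have hn0 : n ≠ 0 := by
    rintro rfl; simp at hn'; linarith
  have hεC : (ε : ℂ) ≠ 0 := by exact_mod_cast hεp.ne'
  have hκC : (κ : ℂ) ≠ 0 := by exact_mod_cast hκp.ne'
  have hInt0 := isInt_integral hU hcp (hre n hn') hw
  obtain ⟨φ, hφ⟩ := isInt_eig hU hcp (hre n hn') hκp hw
  refine ⟨Complex.I * (ε * κ * n) ^ 2 / κ, ?_, φ, ?_⟩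
  · have e1 : Complex.I * (ε * κ * n) ^ 2 / κ = ((ε ^ 2 * κ : ℝ) : ℂ) * (Complex.I * n ^ 2) := by
      push_cast; field_simp
    have e2 : (Complex.I * n ^ 2).im = ε * n.re + e.im := by
      have : Complex.I * n ^ 2 = Complex.I * (ε * n) + (((2 * d ^ 2 : ℝ) : ℂ) + e) := by
        rw [hneq]; push_cast
        linear_combination (-(2 * (d:ℂ) ^ 2 + e)) * Complex.I_sq
      rw [this]
      simp only [Complex.add_im, Complex.ofReal_im, Complex.I_mul_im, Complex.re_ofReal_mul, zero_add]
    rw [e1, Complex.im_ofReal_mul, e2]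
    have h1 : -(ε * d / 4) ≤ e.im := (abs_le.1 ((Complex.abs_im_le_norm e).trans heb)).1
    have h2 : ε * (3 * d / 4) ≤ ε * n.re := mul_le_mul_of_nonneg_left hn hεp.le
    have h3 : ε * d / 2 ≤ ε * n.re + e.im := by linarith
    have h4 := mul_le_mul_of_nonneg_left h3 (by positivity : 0 ≤ ε ^ 2 * κ)
    linarith
  · have : ∫ y in Ioi (0:ℝ), W n y = ((((ε ^ 2 * κ)⁻¹ : ℝ)) : ℂ) := by
      rw [hInt0, hd2, ← he]
      push_cast
      field_simp
      linear_combination -hneq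
    rw [← this]
    exact hφ
end
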